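/- arXiv:2507.19719 — 3 statements merged into one kernel-verified Lean document; each statement's English description precedes it below -/
import Mathlib

section
/- Let k be an algebraically closed field of characteristic different from 2, and let (α,β,γ), (α',β',γ') ∈ k³ satisfy αβγ ≠ 0, α'β'γ' ≠ 0, α+β+γ+αβγ = 0 and α'+β'+γ'+α'β'γ' = 0. Then there exists a graded k-algebra isomorphism S(α,β,γ) ≅ S(α',β',γ') (a k-algebra isomorphism mapping the k-linear span of {x₀,x₁,x₂,x₃} onto the k-linear span of {x₀,x₁,x₂,x₃}) if and only if (α',β',γ') is a cyclic permutation of (α,β,γ) or a cyclic permutation of (−α,−γ,−β), i.e. (α',β',γ') ∈ {(α,β,γ), (β,γ,α), (γ,α,β), (−α,−γ,−β), (−γ,−β,−α), (−β,−α,−γ)}. -/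
noncomputable section

variable (k : Type*) [Field k]

/-- The generators `x₀, x₁, x₂, x₃` of the free algebra `k⟨x₀,x₁,x₂,x₃⟩`. -/
def g4 (i : Fin 4) : FreeAlgebra k (Fin 4) := FreeAlgebra.ι k i

/-- The relation whose induced ring quotient is the quotient of `k⟨x₀,x₁,x₂,x₃⟩` by the
two-sided ideal generated by the six defining elements of `A(α,β,γ)`. -/
def fourRel (α β γ : k) : FreeAlgebra k (Fin 4) → FreeAlgebra k (Fin 4) → Prop := fun a b =>
  b = 0 ∧
    (a = g4 k 0 * g4 k 1 - g4 k 1 * g4 k 0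
          - algebraMap k _ α * (g4 k 2 * g4 k 3 + g4 k 3 * g4 k 2) ∨
     a = g4 k 0 * g4 k 1 + g4 k 1 * g4 k 0 - (g4 k 2 * g4 k 3 - g4 k 3 * g4 k 2) ∨
     a = g4 k 0 * g4 k 2 - g4 k 2 * g4 k 0
          - algebraMap k _ β * (g4 k 3 * g4 k 1 + g4 k 1 * g4 k 3) ∨
     a = g4 k 0 * g4 k 2 + g4 k 2 * g4 k 0 - (g4 k 3 * g4 k 1 - g4 k 1 * g4 k 3) ∨
     a = g4 k 0 * g4 k 3 - g4 k 3 * g4 k 0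
          - algebraMap k _ γ * (g4 k 1 * g4 k 2 + g4 k 2 * g4 k 1) ∨
     a = g4 k 0 * g4 k 3 + g4 k 3 * g4 k 0 - (g4 k 1 * g4 k 2 - g4 k 2 * g4 k 1))

/-- The algebra `A(α,β,γ)`; when `α+β+γ+αβγ = 0` this is the four-dimensional Sklyanin
algebra `S(α,β,γ)`. -/
abbrev SklyA (α β γ : k) : Type _ := RingQuot (fourRel k α β γ)

/-- The images of the generators `x₀, x₁, x₂, x₃` in `A(α,β,γ)`. -/
def agen (α β γ : k) (i : Fin 4) : SklyA k α β γ :=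
  RingQuot.mkAlgHom k (fourRel k α β γ) (g4 k i)

section

variable {k}

/-- The defining relations of `A(α,β,γ)`, imposed on a family `m i j` standing for the
products `xᵢxⱼ`. -/
structure SklyaninRel {W : Type*} [AddCommGroup W] [Module k W] (α β γ : k)
    (m : Fin 4 → Fin 4 → W) : Prop where
  sub01 : m 0 1 - m 1 0 = α • (m 2 3 + m 3 2)
  add01 : m 0 1 + m 1 0 = m 2 3 - m 3 2
  sub02 : m 0 2 - m 2 0 = β • (m 3 1 + m 1 3)
  add02 : m 0 2 + m 2 0 = m 3 1 - m 1 3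
  sub03 : m 0 3 - m 3 0 = γ • (m 1 2 + m 2 1)
  add03 : m 0 3 + m 3 0 = m 1 2 - m 2 1

namespace SklyaninRel

theorem map {W W' : Type*} [AddCommGroup W] [Module k W] [AddCommGroup W'] [Module k W']
    {α β γ : k} {m : Fin 4 → Fin 4 → W} (h : SklyaninRel α β γ m) (f : W →ₗ[k] W') :
    SklyaninRel α β γ fun i j => f (m i j) where
  sub01 := by simpa using congrArg f h.sub01
  add01 := by simpa using congrArg f h.add01
  sub02 := by simpa using congrArg f h.sub02
  add02 := by simpa using congrArg f h.add02
  sub03 := by simpa using congrArg f h.sub03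
  add03 := by simpa using congrArg f h.add03

theorem agen (α β γ : k) :
    SklyaninRel α β γ fun i j => agen k α β γ i * agen k α β γ j := by
  have key : ∀ a, fourRel k α β γ a 0 → RingQuot.mkAlgHom k (fourRel k α β γ) a = 0 :=
    fun a ha => by simpa using RingQuot.mkAlgHom_rel k ha
  constructor <;> rw [← sub_eq_zero] <;> simp only [_root_.agen, Algebra.smul_def]
  · simpa using key _ ⟨rfl, Or.inl rfl⟩
  · simpa using key _ ⟨rfl, Or.inr (Or.inl rfl)⟩
  · simpa using key _ ⟨rfl, Or.inr (Or.inr (Or.inl rfl))⟩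
  · simpa using key _ ⟨rfl, Or.inr (Or.inr (Or.inr (Or.inl rfl)))⟩
  · simpa using key _ ⟨rfl, Or.inr (Or.inr (Or.inr (Or.inr (Or.inl rfl))))⟩
  · simpa using key _ ⟨rfl, Or.inr (Or.inr (Or.inr (Or.inr (Or.inr rfl))))⟩

/-- The algebra homomorphism out of `A(α,β,γ)` determined by a family satisfying its
defining relations. -/
def liftHom {A : Type*} [Ring A] [Algebra k A] {α β γ : k} {y : Fin 4 → A}
    (h : SklyaninRel α β γ fun i j => y i * y j) : SklyA k α β γ →ₐ[k] A :=
  RingQuot.liftAlgHom k ⟨FreeAlgebra.lift k y, by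
    rintro a b ⟨rfl, rfl | rfl | rfl | rfl | rfl | rfl⟩ <;>
      simp only [g4, map_sub, map_add, map_mul, FreeAlgebra.lift_ι_apply, ← Algebra.smul_def,
        map_smul, map_zero, sub_eq_zero]
    exacts [h.sub01, h.add01, h.sub02, h.add02, h.sub03, h.add03]⟩

@[simp]
theorem liftHom_agen {A : Type*} [Ring A] [Algebra k A] {α β γ : k} {y : Fin 4 → A}
    (h : SklyaninRel α β γ fun i j => y i * y j) (i : Fin 4) :
    h.liftHom (_root_.agen k α β γ i) = y i := by
  simp [liftHom, _root_.agen, g4]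

end SklyaninRel

theorem SklyA.algHom_ext {A : Type*} [Ring A] [Algebra k A] {α β γ : k}
    {f g : SklyA k α β γ →ₐ[k] A} (h : ∀ i, f (agen k α β γ i) = g (agen k α β γ i)) :
    f = g :=
  RingQuot.ringQuot_ext' _ _ _ (FreeAlgebra.hom_ext (funext h))

/-- Existence of an isomorphism `A(α,β,γ) ≅ A(α',β',γ')` matching the spans of the generators. -/
def GradedIso (α β γ α' β' γ' : k) : Prop :=
  ∃ e : SklyA k α β γ ≃ₐ[k] SklyA k α' β' γ',
    Submodule.map e.toLinearMap (Submodule.span k (Set.range (agen k α β γ))) =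
      Submodule.span k (Set.range (agen k α' β' γ'))

namespace GradedIso

theorem refl (α β γ : k) : GradedIso α β γ α β γ :=
  ⟨AlgEquiv.refl, Submodule.map_id _⟩

theorem trans {α β γ α' β' γ' α'' β'' γ'' : k} (h : GradedIso α β γ α' β' γ')
    (h' : GradedIso α' β' γ' α'' β'' γ'') : GradedIso α β γ α'' β'' γ'' := by
  obtain ⟨e, he⟩ := h
  obtain ⟨e', he'⟩ := h'
  refine ⟨e.trans e', ?_⟩
  rw [← he', ← he, ← Submodule.map_comp]
  rfl

theorem of_signed_perm {α β γ α' β' γ' : k} (σ : Equiv.Perm (Fin 4)) (ε : Fin 4 → k)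
    (hε : ∀ i, ε i * ε i = 1)
    (h : SklyaninRel α β γ fun i j =>
      (ε i • agen k α' β' γ' (σ i)) * (ε j • agen k α' β' γ' (σ j)))
    (h' : SklyaninRel α' β' γ' fun i j =>
      (ε (σ.symm i) • agen k α β γ (σ.symm i)) * (ε (σ.symm j) • agen k α β γ (σ.symm j))) :
    GradedIso α β γ α' β' γ' := by
  refine ⟨AlgEquiv.ofAlgHom h.liftHom
    (SklyaninRel.liftHom (y := fun i => ε (σ.symm i) • agen k α β γ (σ.symm i)) h')
    (SklyA.algHom_ext fun i => by simp [smul_smul, hε])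
    (SklyA.algHom_ext fun i => by simp [smul_smul, hε]), ?_⟩
  rw [Submodule.map_span, ← Set.range_comp]
  apply le_antisymm <;> rw [Submodule.span_le] <;> rintro _ ⟨i, rfl⟩
  · simpa using Submodule.smul_mem _ (ε i)
      (Submodule.subset_span (Set.mem_range_self (f := agen k α' β' γ') (σ i)))
  · have : agen k α' β' γ' i = ε (σ.symm i) • h.liftHom (agen k α β γ (σ.symm i)) := by
      simp [smul_smul, hε]
    rw [this]
    exact Submodule.smul_mem _ _ (Submodule.subset_span ⟨σ.symm i, rfl⟩)

theorem rotate (α β γ : k) : GradedIso α β γ β γ α := by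
  refine of_signed_perm ⟨![0, 3, 1, 2], ![0, 2, 3, 1], by decide, by decide⟩ 1 (by simp) ?_ ?_
  · obtain ⟨h1, h2, h3, h4, h5, h6⟩ := SklyaninRel.agen β γ α
    constructor <;> simpa [-smul_add]
  · obtain ⟨h1, h2, h3, h4, h5, h6⟩ := SklyaninRel.agen α β γ
    constructor <;> simpa [-smul_add]

theorem reflect (α β γ : k) : GradedIso α β γ (-α) (-γ) (-β) := by
  refine of_signed_perm ⟨![0, 1, 3, 2], ![0, 1, 3, 2], by decide, by decide⟩ ![-1, 1, 1, 1]
    (by simp [Fin.forall_fin_succ]) ?_ ?_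
  · obtain ⟨h1, h2, h3, h4, h5, h6⟩ := SklyaninRel.agen (-α) (-γ) (-β)
    constructor <;> simp only [Equiv.coe_fn_mk, Matrix.cons_val,
      smul_mul_smul_comm]
    exacts [by linear_combination (norm := module) -h1, by linear_combination (norm := module) -h2,
      by linear_combination (norm := module) -h5, by linear_combination (norm := module) -h6,
      by linear_combination (norm := module) -h3, by linear_combination (norm := module) -h4]
  · obtain ⟨h1, h2, h3, h4, h5, h6⟩ := SklyaninRel.agen α β γ
    constructor <;> simp only [Equiv.coe_fn_symm_mk, Matrix.cons_val,
      smul_mul_smul_comm]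
    exacts [by linear_combination (norm := module) -h1, by linear_combination (norm := module) -h2,
      by linear_combination (norm := module) -h5, by linear_combination (norm := module) -h6,
      by linear_combination (norm := module) -h3, by linear_combination (norm := module) -h4]

end GradedIso

/-- The action of the generator `xᵢ` on `k ⊕ V ⊕ k` determined by a bilinear form `B`, where
`V` is spanned by the generators. -/
def truncOp (B : Fin 4 → Fin 4 → k) (i : Fin 4) :
    Module.End k (k × (Fin 4 → k) × k) :=
  LinearMap.prod 0 (LinearMap.prod (LinearMap.single k (fun _ => k) i ∘ₗ LinearMap.fst k _ _)
    (LinearMap.proj i ∘ₗ Matrix.toLin' (Matrix.of B) ∘ₗ LinearMap.fst k _ _ ∘ₗ LinearMap.snd k _ _))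

theorem truncOp_apply (B : Fin 4 → Fin 4 → k) (i : Fin 4) (w : k × (Fin 4 → k) × k) :
    truncOp B i w = (0, Pi.single i w.1, (Matrix.of B).mulVec w.2.1 i) := rfl

theorem truncOp_mul (B : Fin 4 → Fin 4 → k) (i j : Fin 4) :
    truncOp B i * truncOp B j =
      LinearMap.toSpanSingleton k _ (LinearMap.inr k k _ ∘ₗ LinearMap.inr k (Fin 4 → k) k ∘ₗ
        LinearMap.fst k k ((Fin 4 → k) × k)) (B i j) := by
  refine LinearMap.ext fun w => ?_
  simp [truncOp_apply, Module.End.mul_apply, mul_comm]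

/-- The representation of `A(α,β,γ)` on `k ⊕ V ⊕ k` given by a bilinear form orthogonal to the
relations. -/
def truncRep {α β γ : k} {B : Fin 4 → Fin 4 → k} (hB : SklyaninRel α β γ B) :
    SklyA k α β γ →ₐ[k] Module.End k (k × (Fin 4 → k) × k) :=
  SklyaninRel.liftHom (y := truncOp B) <| by
    simp only [truncOp_mul]
    exact hB.map _

theorem truncRep_agen {α β γ : k} {B : Fin 4 → Fin 4 → k} (hB : SklyaninRel α β γ B)
    (i : Fin 4) : truncRep hB (agen k α β γ i) = truncOp B i :=
  SklyaninRel.liftHom_agen _ i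

theorem linearIndependent_agen (α β γ : k) : LinearIndependent k (agen k α β γ) := by
  have h0 : SklyaninRel α β γ (0 : Fin 4 → Fin 4 → k) := by constructor <;> simp
  rw [Fintype.linearIndependent_iff]
  intro c hc i
  have := congrArg (fun a => (truncRep h0 a (1, 0, 0)).2.1 i) hc
  simpa [truncRep_agen, truncOp_apply, Prod.snd_sum, Prod.fst_sum, Finset.sum_apply,
    Pi.single_apply] using this

/-- A homomorphism that is linear on generators pulls back bilinear forms orthogonal to the
relations to bilinear forms orthogonal to the relations. -/
theorem SklyaninRel.congr_matrix {α β γ α' β' γ' : k} (f : SklyA k α β γ →ₐ[k] SklyA k α' β' γ')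
    {M B : Fin 4 → Fin 4 → k}
    (hf : ∀ i, f (_root_.agen k α β γ i) = ∑ j, M i j • _root_.agen k α' β' γ' j)
    (hB : SklyaninRel α' β' γ' B) : SklyaninRel α β γ fun i l => ∑ j, ∑ m, M i j * M l m * B j m := by
  have := (SklyaninRel.agen α β γ).map
    ((LinearMap.snd k _ _ ∘ₗ LinearMap.snd k _ _ ∘ₗ LinearMap.applyₗ (1, 0, 0)) ∘ₗ
      (truncRep hB).toLinearMap ∘ₗ f.toLinearMap)
  convert this using 3 with i j
  simp only [LinearMap.comp_apply, AlgHom.toLinearMap_apply, map_mul, hf, map_sum, map_smul,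
    truncRep_agen, Finset.sum_mul_sum, smul_mul_smul_comm, truncOp_mul]
  simp

theorem Matrix.of_mul_of_eq_one {ι V : Type*} [Fintype ι] [DecidableEq ι] [AddCommGroup V]
    [Module k V] {v w : ι → V} (hv : LinearIndependent k v) {M N : ι → ι → k}
    (hM : ∀ i, ∑ j, M i j • v j = w i) (hN : ∀ j, ∑ i, N j i • w i = v j) :
    Matrix.of N * Matrix.of M = 1 := by
  ext i j
  have hi : ∑ l, ((Matrix.of N * Matrix.of M) i l - (1 : Matrix ι ι k) i l) • v l = 0 := by
    have h := hN i
    simp only [← hM, Finset.smul_sum, smul_smul] at h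
    rw [Finset.sum_comm] at h
    simp only [sub_smul, Finset.sum_sub_distrib, Matrix.mul_apply, Finset.sum_smul,
      Matrix.of_apply, h]
    simp [Matrix.one_apply, ite_smul]
  exact sub_eq_zero.1 (Fintype.linearIndependent_iff.1 hv _ hi j)

theorem GradedIso.exists_matrix {α β γ α' β' γ' : k} (h : GradedIso α β γ α' β' γ') :
    ∃ M N : Fin 4 → Fin 4 → k, Matrix.of M * Matrix.of N = 1 ∧
      ∀ B : Fin 4 → Fin 4 → k, SklyaninRel α' β' γ' B →
        SklyaninRel α β γ fun i l => ∑ j, ∑ m, M i j * M l m * B j m := by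
  obtain ⟨e, he⟩ := h
  have hM : ∀ i, ∃ c : Fin 4 → k, ∑ j, c j • agen k α' β' γ' j = e (agen k α β γ i) := by
    intro i
    rw [← Submodule.mem_span_range_iff_exists_fun, ← he]
    exact Submodule.mem_map_of_mem (Submodule.subset_span ⟨i, rfl⟩)
  have hN : ∀ j, ∃ c : Fin 4 → k, ∑ i, c i • e (agen k α β γ i) = agen k α' β' γ' j := by
    intro j
    have hj : agen k α' β' γ' j ∈ Submodule.span k (Set.range (agen k α' β' γ')) :=
      Submodule.subset_span ⟨j, rfl⟩
    rw [← he, Submodule.map_span, ← Set.range_comp] at hj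
    exact Submodule.mem_span_range_iff_exists_fun k |>.1 hj
  choose M hM using hM
  choose N hN using hN
  exact ⟨M, N, mul_eq_one_comm.1 (Matrix.of_mul_of_eq_one (linearIndependent_agen α' β' γ') hM hN),
    fun B hB => hB.congr_matrix (e : SklyA k α β γ →ₐ[k] SklyA k α' β' γ') fun i => (hM i).symm⟩

/-- An invertible matrix carrying forms orthogonal to the relations to forms orthogonal to the
relations is monomial, since the only symmetric such forms of rank one are the multiples of the
diagonal matrix units. -/
theorem exists_monomial_of_matrix (h2 : (2 : k) ≠ 0) {α β γ α' β' γ' : k}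
    (h0 : α * β * γ ≠ 0) {M N : Fin 4 → Fin 4 → k}
    (hMN : Matrix.of M * Matrix.of N = 1)
    (H : ∀ B : Fin 4 → Fin 4 → k, SklyaninRel α' β' γ' B →
      SklyaninRel α β γ fun i l => ∑ j, ∑ m, M i j * M l m * B j m) :
    ∃ (q : Fin 4 → Fin 4) (d : Fin 4 → k), q.Injective ∧ (∀ i, d i ≠ 0) ∧
      ∀ B : Fin 4 → Fin 4 → k, SklyaninRel α' β' γ' B →
        SklyaninRel α β γ fun i j => d i * d j * B (q i) (q j) := by
  have hα : α ≠ 0 := by rintro rfl; simp at h0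
  have hβ : β ≠ 0 := by rintro rfl; simp at h0
  have hγ : γ ≠ 0 := by rintro rfl; simp at h0
  have hcol : ∀ j i l, i ≠ l → M i j = 0 ∨ M l j = 0 := by
    intro j
    have hB : SklyaninRel α' β' γ' fun i l => if i = j ∧ l = j then (1 : k) else 0 := by
      fin_cases j <;> constructor <;> simp
    have hM := H _ hB
    simp only [ite_and, mul_ite, mul_one, mul_zero, Finset.sum_ite_eq', Finset.mem_univ, if_true,
      Finset.sum_ite_irrel, Finset.sum_const_zero] at hM
    obtain ⟨h1, h1', h3, h3', h5, h5'⟩ := hM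
    simp only [smul_eq_mul] at h1 h3 h5
    have e01 : M 0 j * M 1 j = 0 := mul_left_cancel₀ h2 (by linear_combination h1')
    have e02 : M 0 j * M 2 j = 0 := mul_left_cancel₀ h2 (by linear_combination h3')
    have e03 : M 0 j * M 3 j = 0 := mul_left_cancel₀ h2 (by linear_combination h5')
    have e23 : M 2 j * M 3 j = 0 :=
      mul_left_cancel₀ (mul_ne_zero h2 hα) (by linear_combination -h1)
    have e13 : M 1 j * M 3 j = 0 :=
      mul_left_cancel₀ (mul_ne_zero h2 hβ) (by linear_combination -h3)
    have e12 : M 1 j * M 2 j = 0 :=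
      mul_left_cancel₀ (mul_ne_zero h2 hγ) (by linear_combination -h5)
    intro i l hil
    rw [← mul_eq_zero]
    fin_cases i <;> fin_cases l <;>
      first
      | exact absurd rfl hil
      | (simp only [Fin.reduceFinMk, Fin.zero_eta, Fin.mk_one]
         first | assumption | (rw [mul_comm]; assumption))
  have hrow : ∀ i, ∃ j, M i j ≠ 0 := by
    intro i
    by_contra! hi
    have := congrFun (congrFun hMN i) i
    simp [Matrix.mul_apply, hi] at this
  choose q hq using hrow
  have hinj : q.Injective := by
    intro i l hil
    by_contra hne
    rcases hcol (q i) i l hne with h | h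
    · exact hq i h
    · exact hq l (hil ▸ h)
  have hM : ∀ i j, M i j = if j = q i then M i (q i) else 0 := by
    intro i j
    split_ifs with h
    · rw [h]
    · obtain ⟨l, rfl⟩ := (Finite.injective_iff_surjective.1 hinj) j
      exact (hcol (q l) i l fun hil => h (by rw [hil])).resolve_right (hq l)
  refine ⟨q, fun i => M i (q i), hinj, hq, fun B hB => ?_⟩
  convert H B hB using 3 with i l
  rw [Finset.sum_eq_single (q i) (fun j _ hj => by simp [hM i j, hj]) (by simp),
    Finset.sum_eq_single (q l) (fun j _ hj => by simp [hM l j, hj]) (by simp)]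

/-- The coefficients for which the relations of `A(α,β,γ)` read
`xᵢxⱼ - xⱼxᵢ = skewCoeff i j • (xₗxₘ + xₘxₗ)` whenever `i, j, l, m` are distinct. -/
def skewCoeff (α β γ : k) : Fin 4 → Fin 4 → k :=
  ![![0, α, β, γ], ![-α, 0, 1, -1], ![-β, -1, 0, 1], ![-γ, 1, -1, 0]]

/-- The bilinear form `skewCoeff i j • (Eᵢⱼ - Eⱼᵢ) + (Eₗₘ + Eₘₗ)`. -/
def dualForm (α β γ : k) (i j l m : Fin 4) (u v : Fin 4) : k :=
  if u = i ∧ v = j then skewCoeff α β γ i j else if u = j ∧ v = i then -skewCoeff α β γ i j else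
    if u = l ∧ v = m ∨ u = m ∧ v = l then 1 else 0

theorem sklyaninRel_dualForm (α β γ : k) {q : Fin 4 → Fin 4} (hq : q.Injective) :
    SklyaninRel α β γ (dualForm α β γ (q 0) (q 1) (q 2) (q 3)) := by
  have h01 := hq.ne (show (0 : Fin 4) ≠ 1 by decide)
  have h02 := hq.ne (show (0 : Fin 4) ≠ 2 by decide)
  have h03 := hq.ne (show (0 : Fin 4) ≠ 3 by decide)
  have h12 := hq.ne (show (1 : Fin 4) ≠ 2 by decide)
  have h13 := hq.ne (show (1 : Fin 4) ≠ 3 by decide)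
  have h23 := hq.ne (show (2 : Fin 4) ≠ 3 by decide)
  clear hq
  generalize q 0 = a, q 1 = b, q 2 = c, q 3 = d at *
  fin_cases a <;> fin_cases b <;> first | exact absurd rfl h01 | skip
  all_goals fin_cases c <;> first | exact absurd rfl h02 | exact absurd rfl h12 | skip
  all_goals fin_cases d <;>
    first | exact absurd rfl h03 | exact absurd rfl h13 | exact absurd rfl h23 | skip
  all_goals constructor <;> simp [dualForm, skewCoeff] <;> ring

/-- A monomial change of generators preserves the products `skewCoeff i j * skewCoeff l m`. -/
theorem skewCoeff_mul_of_monomial (h2 : (2 : k) ≠ 0) {α β γ α' β' γ' : k}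
    {q : Fin 4 → Fin 4} {d : Fin 4 → k} (hq : q.Injective) (hd : ∀ i, d i ≠ 0)
    (H : ∀ B : Fin 4 → Fin 4 → k, SklyaninRel α' β' γ' B →
      SklyaninRel α β γ fun i j => d i * d j * B (q i) (q j)) :
    α = skewCoeff α' β' γ' (q 0) (q 1) * skewCoeff α' β' γ' (q 2) (q 3) ∧
    β = skewCoeff α' β' γ' (q 0) (q 2) * skewCoeff α' β' γ' (q 3) (q 1) ∧
    γ = skewCoeff α' β' γ' (q 0) (q 3) * skewCoeff α' β' γ' (q 1) (q 2) := by
  have key (p : Fin 4 → Fin 4) (hp : p.Injective) :=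
    H _ (sklyaninRel_dualForm α' β' γ' (hq.comp hp))
  have cancel {a b c x y : k} (hx : x ≠ 0) (hy : y ≠ 0) (h : x * b - x * -b = a * (y + y))
      (h' : x + x = y * c - y * -c) : a = b * c := by
    refine mul_left_cancel₀ (mul_ne_zero (mul_ne_zero h2 h2) (mul_ne_zero hx hy)) ?_
    linear_combination -(x + x) * h + (2 * x * b) * h'
  refine ⟨cancel (mul_ne_zero (hd 0) (hd 1)) (mul_ne_zero (hd 2) (hd 3)) ?_ ?_,
    cancel (mul_ne_zero (hd 0) (hd 2)) (mul_ne_zero (hd 3) (hd 1)) ?_ ?_,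
    cancel (mul_ne_zero (hd 0) (hd 3)) (mul_ne_zero (hd 1) (hd 2)) ?_ ?_⟩
  · simpa [dualForm, hq.eq_iff, mul_comm (d 1) (d 0), mul_comm (d 3) (d 2)]
      using (key ![0, 1, 2, 3] (by decide)).sub01
  · simpa [dualForm, hq.eq_iff, mul_comm (d 1) (d 0), mul_comm (d 3) (d 2)]
      using (key ![2, 3, 0, 1] (by decide)).add01
  · simpa [dualForm, hq.eq_iff, mul_comm (d 2) (d 0), mul_comm (d 1) (d 3)]
      using (key ![0, 2, 3, 1] (by decide)).sub02
  · simpa [dualForm, hq.eq_iff, mul_comm (d 2) (d 0), mul_comm (d 1) (d 3)]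
      using (key ![3, 1, 0, 2] (by decide)).add02
  · simpa [dualForm, hq.eq_iff, mul_comm (d 3) (d 0), mul_comm (d 2) (d 1)]
      using (key ![0, 3, 1, 2] (by decide)).sub03
  · simpa [dualForm, hq.eq_iff, mul_comm (d 3) (d 0), mul_comm (d 2) (d 1)]
      using (key ![1, 2, 0, 3] (by decide)).add03

theorem params_of_skewCoeff {α β γ α' β' γ' : k} {q : Fin 4 → Fin 4} (hq : q.Injective)
    (hα : α = skewCoeff α' β' γ' (q 0) (q 1) * skewCoeff α' β' γ' (q 2) (q 3))
    (hβ : β = skewCoeff α' β' γ' (q 0) (q 2) * skewCoeff α' β' γ' (q 3) (q 1))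
    (hγ : γ = skewCoeff α' β' γ' (q 0) (q 3) * skewCoeff α' β' γ' (q 1) (q 2)) :
    (α' = α ∧ β' = β ∧ γ' = γ) ∨ (α' = β ∧ β' = γ ∧ γ' = α) ∨ (α' = γ ∧ β' = α ∧ γ' = β) ∨
     (α' = -α ∧ β' = -γ ∧ γ' = -β) ∨ (α' = -γ ∧ β' = -β ∧ γ' = -α) ∨
     (α' = -β ∧ β' = -α ∧ γ' = -γ) := by
  have h01 := hq.ne (show (0 : Fin 4) ≠ 1 by decide)
  have h02 := hq.ne (show (0 : Fin 4) ≠ 2 by decide)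
  have h03 := hq.ne (show (0 : Fin 4) ≠ 3 by decide)
  have h12 := hq.ne (show (1 : Fin 4) ≠ 2 by decide)
  have h13 := hq.ne (show (1 : Fin 4) ≠ 3 by decide)
  have h23 := hq.ne (show (2 : Fin 4) ≠ 3 by decide)
  clear hq
  subst hα hβ hγ
  generalize q 0 = a, q 1 = b, q 2 = c, q 3 = d at *
  fin_cases a <;> fin_cases b <;> first | exact absurd rfl h01 | skip
  all_goals fin_cases c <;> first | exact absurd rfl h02 | exact absurd rfl h12 | skip
  all_goals fin_cases d <;>
    first | exact absurd rfl h03 | exact absurd rfl h13 | exact absurd rfl h23 | skip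
  all_goals simp [skewCoeff]

end

/-- For four-dimensional Sklyanin algebras with `αβγ ≠ 0` and `α'β'γ' ≠ 0`, there is a graded
`k`-algebra isomorphism `S(α,β,γ) ≅ S(α',β',γ')` if and only if `(α',β',γ')` is a cyclic
permutation of `(α,β,γ)` or of `(−α,−γ,−β)`. -/
theorem sklyanin4_iso_iff [IsAlgClosed k] (hchar : ringChar k ≠ 2) (α β γ α' β' γ' : k)
    (h0 : α * β * γ ≠ 0) (h0' : α' * β' * γ' ≠ 0)
    (hS : α + β + γ + α * β * γ = 0) (hS' : α' + β' + γ' + α' * β' * γ' = 0) :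
    (∃ e : SklyA k α β γ ≃ₐ[k] SklyA k α' β' γ',
      Submodule.map e.toLinearMap (Submodule.span k (Set.range (agen k α β γ))) =
        Submodule.span k (Set.range (agen k α' β' γ'))) ↔
    ((α' = α ∧ β' = β ∧ γ' = γ) ∨ (α' = β ∧ β' = γ ∧ γ' = α) ∨ (α' = γ ∧ β' = α ∧ γ' = β) ∨
     (α' = -α ∧ β' = -γ ∧ γ' = -β) ∨ (α' = -γ ∧ β' = -β ∧ γ' = -α) ∨
     (α' = -β ∧ β' = -α ∧ γ' = -γ)) := by
  have h2 : (2 : k) ≠ 0 := Ring.two_ne_zero hchar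
  constructor
  · intro h
    obtain ⟨M, N, hMN, hM⟩ := GradedIso.exists_matrix h
    obtain ⟨q, d, hq, hd, H⟩ := exists_monomial_of_matrix h2 h0 hMN hM
    obtain ⟨hα, hβ, hγ⟩ := skewCoeff_mul_of_monomial h2 hq hd H
    exact params_of_skewCoeff hq hα hβ hγ
  · rintro (⟨rfl, rfl, rfl⟩ | ⟨rfl, rfl, rfl⟩ | ⟨rfl, rfl, rfl⟩ | ⟨rfl, rfl, rfl⟩ |
      ⟨rfl, rfl, rfl⟩ | ⟨rfl, rfl, rfl⟩)
    · exact GradedIso.refl _ _ _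
    · exact GradedIso.rotate _ _ _
    · exact (GradedIso.rotate _ _ _).trans (GradedIso.rotate _ _ _)
    · exact GradedIso.reflect _ _ _
    · exact (GradedIso.reflect _ _ _).trans (GradedIso.rotate _ _ _)
    · exact ((GradedIso.reflect _ _ _).trans (GradedIso.rotate _ _ _)).trans (GradedIso.rotate _ _ _)
end
end

section
/- Let k be an algebraically closed field possessing a primitive cube root of unity (so char(k) ≠ 3), and let (p,q,r) ∈ k³ be a nonzero degenerate triple. Then the degenerate three-dimensional Sklyanin algebra S(p,q,r) has zero divisors (it is not a domain) and is not a Noetherian ring. -/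
noncomputable section

variable (k : Type*) [Field k]

/-- The generators `x = g3 0`, `y = g3 1`, `z = g3 2` of the free algebra `k⟨x,y,z⟩`. -/
def g3 (i : Fin 3) : FreeAlgebra k (Fin 3) := FreeAlgebra.ι k i

/-- The relation whose induced ring quotient is the quotient of `k⟨x,y,z⟩` by the two-sided
ideal generated by `p·yz + q·zy + r·x²`, `p·zx + q·xz + r·y²` and `p·xy + q·yx + r·z²`. -/
def sklyRel (p q r : k) : FreeAlgebra k (Fin 3) → FreeAlgebra k (Fin 3) → Prop := fun a b =>
  b = 0 ∧
    (a = algebraMap k _ p * (g3 k 1 * g3 k 2) + algebraMap k _ q * (g3 k 2 * g3 k 1)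
          + algebraMap k _ r * (g3 k 0 * g3 k 0) ∨
     a = algebraMap k _ p * (g3 k 2 * g3 k 0) + algebraMap k _ q * (g3 k 0 * g3 k 2)
          + algebraMap k _ r * (g3 k 1 * g3 k 1) ∨
     a = algebraMap k _ p * (g3 k 0 * g3 k 1) + algebraMap k _ q * (g3 k 1 * g3 k 0)
          + algebraMap k _ r * (g3 k 2 * g3 k 2))

/-- The three-dimensional Sklyanin algebra `S(p,q,r)`. -/
abbrev Skly3 (p q r : k) : Type _ := RingQuot (sklyRel k p q r)

/-- The images of the generators `x, y, z` in `S(p,q,r)`. -/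
def sgen (p q r : k) (i : Fin 3) : Skly3 k p q r :=
  RingQuot.mkAlgHom k (sklyRel k p q r) (g3 k i)

/-- A nonzero triple `(p,q,r)` is degenerate if it is a scalar multiple of `(1,0,0)`,
`(0,1,0)` or `(0,0,1)`, or if `p³ = q³ = r³`. -/
def Degenerate (p q r : k) : Prop :=
  (q = 0 ∧ r = 0) ∨ (p = 0 ∧ r = 0) ∨ (p = 0 ∧ q = 0) ∨ (p ^ 3 = q ^ 3 ∧ q ^ 3 = r ^ 3)

variable {k}

/-- The linear form `c 0 * x + c 1 * y + c 2 * z` in `S(p,q,r)`. -/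
def sklyLinear (p q r : k) (c : Fin 3 → k) : Skly3 k p q r :=
  ∑ i, c i • sgen k p q r i

/-- Three elements of an algebra satisfying the Sklyanin relations define an algebra
homomorphism from `S(p,q,r)`. -/
theorem exists_skly3_algHom {B : Type*} [Ring B] [Algebra k B] {p q r : k} (X : Fin 3 → B)
    (h₀ : p • (X 1 * X 2) + q • (X 2 * X 1) + r • (X 0 * X 0) = 0)
    (h₁ : p • (X 2 * X 0) + q • (X 0 * X 2) + r • (X 1 * X 1) = 0)
    (h₂ : p • (X 0 * X 1) + q • (X 1 * X 0) + r • (X 2 * X 2) = 0) :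
    ∃ φ : Skly3 k p q r →ₐ[k] B, ∀ i, φ (sgen k p q r i) = X i := by
  refine ⟨RingQuot.liftAlgHom k ⟨FreeAlgebra.lift k X, ?_⟩, fun i => ?_⟩
  · rintro a b ⟨rfl, rfl | rfl | rfl⟩
    · simpa [g3, Algebra.smul_def] using h₀
    · simpa [g3, Algebra.smul_def] using h₁
    · simpa [g3, Algebra.smul_def] using h₂
  · simp [sgen, g3]

/-- The defining relations of `S(p,q,r)`. -/
theorem sgen_relations (p q r : k) :
    p • (sgen k p q r 1 * sgen k p q r 2) + q • (sgen k p q r 2 * sgen k p q r 1)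
        + r • (sgen k p q r 0 * sgen k p q r 0) = 0 ∧
      p • (sgen k p q r 2 * sgen k p q r 0) + q • (sgen k p q r 0 * sgen k p q r 2)
        + r • (sgen k p q r 1 * sgen k p q r 1) = 0 ∧
      p • (sgen k p q r 0 * sgen k p q r 1) + q • (sgen k p q r 1 * sgen k p q r 0)
        + r • (sgen k p q r 2 * sgen k p q r 2) = 0 := by
  have key : ∀ {a}, sklyRel k p q r a 0 → RingQuot.mkAlgHom k (sklyRel k p q r) a = 0 :=
    fun h => (RingQuot.mkAlgHom_rel k h).trans (map_zero _)
  refine ⟨?_, ?_, ?_⟩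
  · simpa [sgen, Algebra.smul_def] using key ⟨rfl, Or.inl rfl⟩
  · simpa [sgen, Algebra.smul_def] using key ⟨rfl, Or.inr (Or.inl rfl)⟩
  · simpa [sgen, Algebra.smul_def] using key ⟨rfl, Or.inr (Or.inr rfl)⟩

/-- A linear form with a nonzero coefficient is nonzero in `S(p,q,r)`. -/
theorem sklyLinear_ne_zero (p q r : k) {c : Fin 3 → k} {i : Fin 3} (hi : c i ≠ 0) :
    sklyLinear p q r c ≠ 0 := by
  obtain ⟨φ, hφ⟩ := exists_skly3_algHom (p := p) (q := q) (r := r)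
    (fun j => if j = i then (DualNumber.eps : DualNumber k) else 0)
    (by fin_cases i <;> simp) (by fin_cases i <;> simp) (by fin_cases i <;> simp)
  intro h
  apply hi
  simpa [sklyLinear, hφ] using congrArg TrivSqZeroExt.snd (congrArg φ h)

/-- Two linear forms whose tensor product is a combination of the Sklyanin relations have
product zero. -/
theorem sklyLinear_mul_eq_zero {p q r : k} {f g : Fin 3 → k} (t : Fin 3 → k)
    (h00 : f 0 * g 0 = t 0 * r) (h12 : f 1 * g 2 = t 0 * p) (h21 : f 2 * g 1 = t 0 * q)
    (h11 : f 1 * g 1 = t 1 * r) (h20 : f 2 * g 0 = t 1 * p) (h02 : f 0 * g 2 = t 1 * q)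
    (h22 : f 2 * g 2 = t 2 * r) (h01 : f 0 * g 1 = t 2 * p) (h10 : f 1 * g 0 = t 2 * q) :
    sklyLinear p q r f * sklyLinear p q r g = 0 := by
  obtain ⟨e₀, e₁, e₂⟩ := sgen_relations p q r
  have e := congrArg₂ (· + ·) (congrArg₂ (· + ·) (congrArg (t 0 • ·) e₀)
    (congrArg (t 1 • ·) e₁)) (congrArg (t 2 • ·) e₂)
  simp only [smul_zero, add_zero] at e
  refine Eq.trans ?_ e
  simp only [sklyLinear, Fin.sum_univ_three, add_mul, mul_add, smul_mul_smul_comm, smul_add,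
    smul_smul, h00, h12, h21, h11, h20, h02, h22, h01, h10]
  abel

/-- The weighted backward shift on sequences. -/
def weightedShift (s : ℕ → k) : Module.End k (ℕ → k) where
  toFun m j := s j * m (j + 1)
  map_add' m m' := by ext j; simp [mul_add]
  map_smul' a m := by ext j; simp [mul_left_comm]

@[simp]
theorem weightedShift_apply (s m : ℕ → k) (j : ℕ) :
    weightedShift s m j = s j * m (j + 1) := rfl

theorem weightedShift_one_pow_apply (n : ℕ) (m : ℕ → k) (j : ℕ) :
    (weightedShift (1 : ℕ → k) ^ n) m j = m (j + n) := by
  induction n generalizing m j with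
  | zero => rfl
  | succ n ih => simp [pow_succ, ih, add_assoc]

/-- A ring acting on a module is not left Noetherian if there are elements `a n` and vectors
`v n` such that `a n` kills the `v j` with `n < j`, but not `v n`. -/
theorem not_isNoetherianRing_of_end {A M : Type*} [Ring A] [Algebra k A] [AddCommGroup M]
    [Module k M] (φ : A →ₐ[k] Module.End k M) (a : ℕ → A) (v : ℕ → M)
    (hzero : ∀ n j, n < j → φ (a n) (v j) = 0) (hne : ∀ n, φ (a n) (v n) ≠ 0) :
    ¬ IsNoetherianRing A := by
  intro hA
  let I : ℕ →o Submodule A A :=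
    { toFun := fun n =>
        { carrier := {s | ∀ j, n ≤ j → φ s (v j) = 0}
          add_mem' := fun hs ht j hj => by simp [hs j hj, ht j hj]
          zero_mem' := fun j _ => by simp
          smul_mem' := fun c s hs j hj => by simp [hs j hj] }
      monotone' := fun m n hmn s hs j hj => hs j (hmn.trans hj) }
  obtain ⟨n, hn⟩ := monotone_stabilizes_iff_noetherian.mpr hA I
  have hmem : a n ∈ I (n + 1) := fun j hj => hzero n j hj
  rw [← hn (n + 1) n.le_succ] at hmem
  exact hne n (hmem n le_rfl)

/-- A point module of `S(p,q,r)`, given by a sequence of points `P j`, shows that `S(p,q,r)` is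
not left Noetherian as soon as some linear form `l` vanishes at all points except the first. -/
theorem not_isNoetherianRing_skly3_of_points {p q r : k} (P : ℕ → Fin 3 → k) (l h : Fin 3 → k)
    (h₀ : ∀ j, p * (P j 1 * P (j + 1) 2) + q * (P j 2 * P (j + 1) 1)
      + r * (P j 0 * P (j + 1) 0) = 0)
    (h₁ : ∀ j, p * (P j 2 * P (j + 1) 0) + q * (P j 0 * P (j + 1) 2)
      + r * (P j 1 * P (j + 1) 1) = 0)
    (h₂ : ∀ j, p * (P j 0 * P (j + 1) 1) + q * (P j 1 * P (j + 1) 0)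
      + r * (P j 2 * P (j + 1) 2) = 0)
    (hl₀ : ∑ i, l i * P 0 i ≠ 0) (hl : ∀ j, ∑ i, l i * P (j + 1) i = 0)
    (hh : ∀ j, ∑ i, h i * P j i = 1) :
    ¬ IsNoetherianRing (Skly3 k p q r) := by
  obtain ⟨φ, hφ⟩ := exists_skly3_algHom (p := p) (q := q) (r := r)
    (fun i => weightedShift fun j => P j i)
    (by ext m : 1; ext j; simp; linear_combination m (j + 1 + 1) * h₀ j)
    (by ext m : 1; ext j; simp; linear_combination m (j + 1 + 1) * h₁ j)
    (by ext m : 1; ext j; simp; linear_combination m (j + 1 + 1) * h₂ j)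
  have hlin : ∀ c, φ (sklyLinear p q r c) = weightedShift fun j => ∑ i, c i * P j i := by
    intro c
    ext m : 1
    ext j
    simp [sklyLinear, hφ, Fin.sum_univ_three]
    ring
  have hh' : φ (sklyLinear p q r h) = weightedShift 1 := by
    rw [hlin]
    exact congrArg weightedShift (funext hh)
  refine not_isNoetherianRing_of_end φ
    (fun n => sklyLinear p q r l * sklyLinear p q r h ^ n) (fun n => Pi.single (n + 1) 1)
    (fun n j hnj => ?_) (fun n hn => ?_)
  · ext i
    simp only [map_mul, map_pow, hh', hlin, Module.End.mul_apply, weightedShift_apply,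
      weightedShift_one_pow_apply]
    cases i with
    | zero =>
      rw [Pi.single_eq_of_ne (by omega)]
      simp
    | succ i =>
      rw [hl]
      simp
  · apply hl₀
    have := congrFun hn 0
    simp only [map_mul, map_pow, hh', hlin, Module.End.mul_apply, weightedShift_apply,
      weightedShift_one_pow_apply] at this
    simpa [add_comm 1 n] using this

/-- The sequence `A, B, C, B, C, …`. -/
def alternating {α : Type*} (A B C : α) (j : ℕ) : α :=
  if j = 0 then A else if Odd j then B else C

theorem alternating_consecutive {α : Type*} {A B C : α} {R : α → α → Prop}
    (hAB : R A B) (hBC : R B C) (hCB : R C B) (j : ℕ) :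
    R (alternating A B C j) (alternating A B C (j + 1)) := by
  rcases Nat.eq_zero_or_pos j with rfl | hj
  · simpa [alternating] using hAB
  · by_cases ho : Odd j <;> simp [alternating, hj.ne', Nat.odd_add_one, ho, hBC, hCB]

theorem alternating_succ {α : Type*} {A B C : α} {R : α → Prop}
    (hB : R B) (hC : R C) (j : ℕ) : R (alternating A B C (j + 1)) := by
  by_cases ho : Odd j <;> simp [alternating, Nat.odd_add_one, ho, hB, hC]

/-- The criterion `not_isNoetherianRing_skly3_of_points` for the points `A, B, C, B, C, …`. -/
theorem not_isNoetherianRing_of_alternating {p q r : k} (A B C l h : Fin 3 → k)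
    (hR : ∀ D ∈ [(A, B), (B, C), (C, B)],
      p * (D.1 1 * D.2 2) + q * (D.1 2 * D.2 1) + r * (D.1 0 * D.2 0) = 0 ∧
      p * (D.1 2 * D.2 0) + q * (D.1 0 * D.2 2) + r * (D.1 1 * D.2 1) = 0 ∧
      p * (D.1 0 * D.2 1) + q * (D.1 1 * D.2 0) + r * (D.1 2 * D.2 2) = 0)
    (hlA : ∑ i, l i * A i ≠ 0) (hlB : ∑ i, l i * B i = 0) (hlC : ∑ i, l i * C i = 0)
    (hhA : ∑ i, h i * A i = 1) (hhB : ∑ i, h i * B i = 1) (hhC : ∑ i, h i * C i = 1) :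
    ¬ IsNoetherianRing (Skly3 k p q r) := by
  simp only [List.forall_mem_cons, List.not_mem_nil] at hR
  obtain ⟨hAB, hBC, hCB, -⟩ := hR
  have hcons := alternating_consecutive (R := fun D E : Fin 3 → k =>
      p * (D 1 * E 2) + q * (D 2 * E 1) + r * (D 0 * E 0) = 0 ∧
      p * (D 2 * E 0) + q * (D 0 * E 2) + r * (D 1 * E 1) = 0 ∧
      p * (D 0 * E 1) + q * (D 1 * E 0) + r * (D 2 * E 2) = 0) hAB hBC hCB
  refine not_isNoetherianRing_skly3_of_points (alternating A B C) l h (fun j => (hcons j).1)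
    (fun j => (hcons j).2.1) (fun j => (hcons j).2.2) hlA
    (alternating_succ (R := fun D : Fin 3 → k => ∑ i, l i * D i = 0) hlB hlC) fun j => ?_
  cases j with
  | zero => exact hhA
  | succ j => exact alternating_succ (R := fun D : Fin 3 → k => ∑ i, h i * D i = 1) hhB hhC j

/-- The assertion that `S(p,q,r)` has zero divisors and is not left Noetherian. -/
def Skly3.HasZeroDivisorsNotNoetherian (p q r : k) : Prop :=
  (∃ a b : Skly3 k p q r, a ≠ 0 ∧ b ≠ 0 ∧ a * b = 0) ∧ ¬ IsNoetherianRing (Skly3 k p q r)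

namespace Skly3.HasZeroDivisorsNotNoetherian

theorem of_left {p : k} (hp : p ≠ 0) : HasZeroDivisorsNotNoetherian p 0 0 := by
  constructor
  · refine ⟨sklyLinear p 0 0 ![1, 0, 0], sklyLinear p 0 0 ![0, 1, 0],
      sklyLinear_ne_zero _ _ _ (i := 0) (by simp), sklyLinear_ne_zero _ _ _ (i := 1) (by simp),
      sklyLinear_mul_eq_zero ![0, 0, p⁻¹] ?_ ?_ ?_ ?_ ?_ ?_ ?_ ?_ ?_⟩ <;> simp [hp]
  · refine not_isNoetherianRing_of_alternating
      ![0, 0, 1] ![0, 1, 0] ![0, 1, 0] ![0, 0, 1] ![0, 1, 1] ?_ ?_ ?_ ?_ ?_ ?_ ?_ <;>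
    simp [Fin.sum_univ_three]

theorem of_middle {q : k} (hq : q ≠ 0) : HasZeroDivisorsNotNoetherian 0 q 0 := by
  constructor
  · refine ⟨sklyLinear 0 q 0 ![0, 1, 0], sklyLinear 0 q 0 ![1, 0, 0],
      sklyLinear_ne_zero _ _ _ (i := 1) (by simp), sklyLinear_ne_zero _ _ _ (i := 0) (by simp),
      sklyLinear_mul_eq_zero ![0, 0, q⁻¹] ?_ ?_ ?_ ?_ ?_ ?_ ?_ ?_ ?_⟩ <;> simp [hq]
  · refine not_isNoetherianRing_of_alternating
      ![1, 0, 0] ![0, 1, 0] ![0, 1, 0] ![1, 0, 0] ![1, 1, 0] ?_ ?_ ?_ ?_ ?_ ?_ ?_ <;>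
    simp [Fin.sum_univ_three]

theorem of_right {r : k} (hr : r ≠ 0) : HasZeroDivisorsNotNoetherian 0 0 r := by
  constructor
  · refine ⟨sklyLinear 0 0 r ![1, 0, 0], sklyLinear 0 0 r ![1, 0, 0],
      sklyLinear_ne_zero _ _ _ (i := 0) (by simp), sklyLinear_ne_zero _ _ _ (i := 0) (by simp),
      sklyLinear_mul_eq_zero ![r⁻¹, 0, 0] ?_ ?_ ?_ ?_ ?_ ?_ ?_ ?_ ?_⟩ <;> simp [hr]
  · refine not_isNoetherianRing_of_alternating
      ![1, 0, 0] ![0, 1, 0] ![0, 0, 1] ![1, 0, 0] ![1, 1, 1] ?_ ?_ ?_ ?_ ?_ ?_ ?_ <;>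
    simp [Fin.sum_univ_three]

theorem of_eq {p s w : k} (hp : p ≠ 0) (hs : s ^ 3 = 1) (hw : w ^ 2 + w + 1 = 0)
    (h3 : (3 : k) ≠ 0) : HasZeroDivisorsNotNoetherian p p (p * s) := by
  constructor
  · refine ⟨sklyLinear p p (p * s) ![p, p, p * s ^ 2], sklyLinear p p (p * s) ![1, 1, s ^ 2],
      sklyLinear_ne_zero _ _ _ (i := 0) (by simpa using hp),
      sklyLinear_ne_zero _ _ _ (i := 0) (by simp),
      sklyLinear_mul_eq_zero ![s ^ 2, s ^ 2, 1] ?_ ?_ ?_ ?_ ?_ ?_ ?_ ?_ ?_⟩ <;>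
    simp only [Matrix.cons_val]
    · linear_combination -p * hs
    · ring
    · ring
    · linear_combination -p * hs
    · ring
    · ring
    · linear_combination p * s * hs
    · ring
    · ring
  · refine not_isNoetherianRing_of_alternating
      ![1, 1, s] ![1, w, s * w ^ 2] ![1, w ^ 2, s * w] ![1, 1, s ^ 2] ![1, 0, 0]
      ?_ ?_ ?_ ?_ ?_ ?_ ?_
    · simp only [List.forall_mem_cons, List.not_mem_nil, Matrix.cons_val]
      refine ⟨⟨?_, ?_, ?_⟩, ⟨?_, ?_, ?_⟩, ⟨?_, ?_, ?_⟩, by simp⟩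
      · linear_combination p * s * hw
      · linear_combination p * s * hw
      · linear_combination p * hw + p * w ^ 2 * hs
      · linear_combination p * s * (w ^ 2 - w + 1) * hw
      · linear_combination p * s * w * hw
      · linear_combination p * w * hw + p * w ^ 3 * hs
      · linear_combination p * s * (w ^ 2 - w + 1) * hw
      · linear_combination p * s * w * hw
      · linear_combination p * w * hw + p * w ^ 3 * hs
    · convert h3 using 1
      simp only [Fin.sum_univ_three, Matrix.cons_val]
      linear_combination hs
    · simp only [Fin.sum_univ_three, Matrix.cons_val]
      linear_combination hw + w ^ 2 * hs
    · simp only [Fin.sum_univ_three, Matrix.cons_val]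
      linear_combination hw + w * hs
    all_goals simp [Fin.sum_univ_three]

theorem of_ne {p u s : k} (hp : p ≠ 0) (hs : s ^ 3 = 1) (hu : u ^ 2 + u + 1 = 0)
    (hu1 : u ≠ 1) : HasZeroDivisorsNotNoetherian p (p * u) (p * s) := by
  have hu3 : u ^ 3 = 1 := by linear_combination (u - 1) * hu
  constructor
  · refine ⟨sklyLinear p (p * u) (p * s) ![p, p * u, p * s ^ 2 * u],
      sklyLinear p (p * u) (p * s) ![1, 1, s ^ 2 * u ^ 2],
      sklyLinear_ne_zero _ _ _ (i := 0) (by simpa using hp),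
      sklyLinear_ne_zero _ _ _ (i := 0) (by simp),
      sklyLinear_mul_eq_zero ![s ^ 2, s ^ 2 * u, 1] ?_ ?_ ?_ ?_ ?_ ?_ ?_ ?_ ?_⟩ <;>
    simp only [Matrix.cons_val]
    · linear_combination -p * hs
    · linear_combination p * s ^ 2 * hu3
    · ring
    · linear_combination -p * u * hs
    · ring
    · ring
    · linear_combination p * s * u ^ 3 * hs + p * s * hu3
    · ring
    · ring
  · refine not_isNoetherianRing_of_alternating
      ![1, u, s] ![1, 1, s * u] ![1, 1, s * u] ![-1, 1, 0] ![1, 0, 0] ?_ ?_ ?_ ?_ ?_ ?_ ?_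
    · simp only [List.forall_mem_cons, List.not_mem_nil, Matrix.cons_val]
      have hBB : p * (1 * (s * u)) + p * u * (s * u * 1) + p * s * (1 * 1) = 0 ∧
          p * (s * u * 1) + p * u * (1 * (s * u)) + p * s * (1 * 1) = 0 ∧
          p * (1 * 1) + p * u * (1 * 1) + p * s * (s * u * (s * u)) = 0 := by
        refine ⟨?_, ?_, ?_⟩
        · linear_combination p * s * hu
        · linear_combination p * s * hu
        · linear_combination p * hu + p * u ^ 2 * hs
      refine ⟨⟨?_, ?_, ?_⟩, hBB, hBB, by simp⟩
      · linear_combination p * s * hu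
      · linear_combination p * s * hu
      · linear_combination p * hu + p * u * hs
    · convert sub_ne_zero.mpr hu1 using 1
      simp only [Fin.sum_univ_three, Matrix.cons_val]
      ring
    all_goals simp [Fin.sum_univ_three]

end Skly3.HasZeroDivisorsNotNoetherian

variable (k)

/-- If `k` is algebraically closed with a primitive cube root of unity and `(p,q,r)` is a
nonzero degenerate triple, then the degenerate Sklyanin algebra `S(p,q,r)` has zero divisors
and is not a (left and right) Noetherian ring. -/
theorem degenerate_sklyanin3_zero_divisors_not_noetherian [IsAlgClosed k]
    (hroot : ∃ ω : k, IsPrimitiveRoot ω 3) (p q r : k)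
    (hne : ¬(p = 0 ∧ q = 0 ∧ r = 0)) (hdeg : Degenerate k p q r) :
    (∃ a b : Skly3 k p q r, a ≠ 0 ∧ b ≠ 0 ∧ a * b = 0) ∧
    ¬(IsNoetherianRing (Skly3 k p q r) ∧ IsNoetherianRing (Skly3 k p q r)ᵐᵒᵖ) := by
  suffices h : Skly3.HasZeroDivisorsNotNoetherian p q r from ⟨h.1, fun hN => h.2 hN.1⟩
  rcases hdeg with ⟨rfl, rfl⟩ | ⟨rfl, rfl⟩ | ⟨rfl, rfl⟩ | ⟨hpq, hqr⟩
  · exact .of_left fun h => hne ⟨h, rfl, rfl⟩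
  · exact .of_middle fun h => hne ⟨rfl, h, rfl⟩
  · exact .of_right fun h => hne ⟨rfl, rfl, h⟩
  · have hp : p ≠ 0 := by
      rintro rfl
      have hq : q = 0 := by simpa using hpq.symm
      subst hq
      exact hne ⟨rfl, rfl, by simpa using hqr.symm⟩
    obtain ⟨u, rfl⟩ : ∃ u, q = p * u := ⟨q / p, by field_simp⟩
    obtain ⟨s, rfl⟩ : ∃ s, r = p * s := ⟨r / p, by field_simp⟩
    have hp3 : p ^ 3 ≠ 0 := pow_ne_zero 3 hp
    have hu : u ^ 3 = 1 := mul_left_cancel₀ hp3 (by linear_combination -hpq)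
    have hs : s ^ 3 = 1 := mul_left_cancel₀ hp3 (by linear_combination -hpq - hqr)
    by_cases hu1 : u = 1
    · subst hu1
      obtain ⟨w, hw⟩ := hroot
      have hw1 : w - 1 ≠ 0 := sub_ne_zero.mpr (hw.ne_one (by norm_num))
      have hw2 : w ^ 2 + w + 1 = 0 :=
        mul_left_cancel₀ hw1 (by linear_combination hw.pow_eq_one)
      rw [mul_one]
      have : NeZero ((3 : ℕ) : k) := hw.neZero'
      exact .of_eq hp hs hw2 (by exact_mod_cast this.out)
    · have hu2 : u ^ 2 + u + 1 = 0 :=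
        mul_left_cancel₀ (sub_ne_zero.mpr hu1) (by linear_combination hu)
      exact .of_ne hp hs hu2 hu1
end
end

section
/- Let k be an algebraically closed field and let (p,q,r) ∈ k³ be a non-degenerate triple. Then for every natural number n, the image in S(p,q,r) of the k-linear span of all words of length n in the generators x, y, z has k-vector space dimension equal to the binomial coefficient C(n+2, 2) = (n+1)(n+2)/2; that is, the non-degenerate three-dimensional Sklyanin algebra S(p,q,r) has the Hilbert series 1/(1−t)³ of a commutative polynomial ring in 3 variables. -/
noncomputable section

variable (k : Type*) [Field k]

/-- The image in `S(p,q,r)` of the `k`-linear span of all words of length `n` in the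
generators. -/
def gradedPiece3 (p q r : k) (n : ℕ) : Submodule k (Skly3 k p q r) :=
  Submodule.span k
    {s : Skly3 k p q r | ∃ w : List (Fin 3), w.length = n ∧ s = (w.map (sgen k p q r)).prod}

namespace Sklyanin3

open Polynomial Matrix

section LinearAlgebra

variable {k}

/-- The coefficients of the linear combination of the defining relations with coefficients `c`:
the entry `(i, l)` is the coefficient of the word `xᵢ xₗ`. -/
def relMatrix (p q r : k) (c : Fin 3 → k) : Matrix (Fin 3) (Fin 3) k :=
  !![r * c 0, p * c 2, q * c 1; q * c 2, r * c 1, p * c 0; p * c 1, q * c 0, r * c 2]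

theorem degenerate_swap {p q r : k} (h : Degenerate k q p r) : Degenerate k p q r := by
  unfold Degenerate at *
  rcases h with h | h | h | ⟨h, h'⟩
  · exact Or.inr (Or.inl h)
  · exact Or.inl h
  · exact Or.inr (Or.inr (Or.inl h.symm))
  · exact Or.inr (Or.inr (Or.inr ⟨h.symm, h.trans h'⟩))

theorem degenerate_of_mul_eq_zero {p q r : k} (hpq : p * q = 0) (hqr : q * r = 0)
    (hpr : p * r = 0) : Degenerate k p q r := by
  unfold Degenerate
  simp only [mul_eq_zero] at hpq hqr hpr
  tauto

theorem degenerate_of_minors {p q r a b c : k} (hc : c ≠ 0) (hr : r ^ 2 * (a * b) = p * q * c ^ 2)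
    (hp : p ^ 2 * (a * b) = q * r * c ^ 2) (hq : q ^ 2 * (a * b) = p * r * c ^ 2) :
    Degenerate k p q r := by
  by_cases hab : a * b = 0
  · have hc2 : c ^ 2 ≠ 0 := pow_ne_zero 2 hc
    simp only [hab, mul_zero, zero_eq_mul, hc2, or_false] at hr hp hq
    exact degenerate_of_mul_eq_zero (by simpa using hr) (by simpa using hp) (by simpa using hq)
  · refine Or.inr (Or.inr (Or.inr ⟨mul_right_cancel₀ hab ?_, mul_right_cancel₀ hab ?_⟩))
    · linear_combination p * hp - q * hq
    · linear_combination q * hq - r * hr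

theorem exists_minor_ne_zero {p q r : k} (h : ¬ Degenerate k p q r) {c : Fin 3 → k} (hc : c ≠ 0) :
    ∃ i j, relMatrix p q r c i ⨯₃ relMatrix p q r c j ≠ 0 := by
  by_contra! H
  have h01 := H 0 1
  have h02 := H 0 2
  have h12 := H 1 2
  simp only [cross_apply, relMatrix, funext_iff, Fin.forall_fin_succ] at h01 h02 h12
  simp at h01 h02 h12
  obtain ⟨a1, a2, a3⟩ := h01
  obtain ⟨b1, b2, b3⟩ := h02
  obtain ⟨c1, c2, c3⟩ := h12
  have hc0 : c 0 = 0 := by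
    by_contra hi
    exact h <| degenerate_of_minors (a := c 1) (b := c 2) hi (by linear_combination c1)
      (by linear_combination -b3) (by linear_combination a2)
  have hc1 : c 1 = 0 := by
    by_contra hi
    exact h <| degenerate_of_minors (a := c 0) (b := c 2) hi (by linear_combination -b2)
      (by linear_combination a1) (by linear_combination c3)
  have hc2 : c 2 = 0 := by
    by_contra hi
    exact h <| degenerate_of_minors (a := c 0) (b := c 1) hi (by linear_combination a3)
      (by linear_combination c2) (by linear_combination -b1)
  exact hc (by ext i; fin_cases i <;> assumption)

theorem vecMul_relMatrix (p q r : k) (P c : Fin 3 → k) :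
    P ᵥ* relMatrix p q r c = c ᵥ* relMatrix q p r P := by
  ext i
  fin_cases i <;> simp [relMatrix, vecMul, dotProduct, Fin.sum_univ_three] <;> ring

theorem exists_dotProduct_eq_one {v : Fin 3 → k} (hv : v ≠ 0) : ∃ d : Fin 3 → k, v ⬝ᵥ d = 1 := by
  obtain ⟨i, hi⟩ := Function.ne_iff.1 hv
  exact ⟨Pi.single i (v i)⁻¹, by simpa using mul_inv_cancel₀ hi⟩

theorem eq_combination_of_dotProduct_cross {a b h t : Fin 3 → k} (hh : (a ⨯₃ b) ⬝ᵥ h = 1)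
    (ht : t ⬝ᵥ (a ⨯₃ b) = 0) : t = (t ⬝ᵥ (b ⨯₃ h)) • a + (t ⬝ᵥ (h ⨯₃ a)) • b := by
  simp only [cross_apply, vec3_dotProduct] at hh ht ⊢
  simp at hh ht ⊢
  ext i
  fin_cases i <;> simp
  · linear_combination (-t 0) * hh + h 0 * ht
  · linear_combination (-t 1) * hh + h 1 * ht
  · linear_combination (-t 2) * hh + h 2 * ht

theorem exists_cross_eq {v P : Fin 3 → k} (hv : v ≠ 0) (hP : v ⬝ᵥ P = 0) :
    ∃ w, v ⨯₃ w = P := by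
  obtain ⟨d, hd⟩ := exists_dotProduct_eq_one hv
  refine ⟨P ⨯₃ d, ?_⟩
  simp only [cross_apply, vec3_dotProduct] at hd hP ⊢
  ext i
  fin_cases i <;> simp
  · linear_combination P 0 * hd - d 0 * hP
  · linear_combination P 1 * hd - d 1 * hP
  · linear_combination P 2 * hd - d 2 * hP

theorem det_relMatrix (p q r : k) (P : Fin 3 → k) :
    (relMatrix p q r P).det = (p ^ 3 + q ^ 3 + r ^ 3) * (P 0 * P 1 * P 2)
      - p * q * r * (P 0 ^ 3 + P 1 ^ 3 + P 2 ^ 3) := by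
  simp [relMatrix, det_fin_three]
  ring

theorem exists_cubic_root [IsAlgClosed k] {a b c d : k} (ha : a ≠ 0) :
    ∃ t : k, a * t ^ 3 + b * t ^ 2 + c * t + d = 0 := by
  obtain ⟨t, ht⟩ := IsAlgClosed.exists_root (Cubic.toPoly ⟨a, b, c, d⟩)
    (by rw [Cubic.degree_of_a_ne_zero ha]; decide)
  exact ⟨t, by simpa [Cubic.toPoly, IsRoot] using ht⟩

theorem exists_two_orthogonal {v : Fin 3 → k} (hv : v ≠ 0) :
    ∃ P Q : Fin 3 → k, v ⬝ᵥ P = 0 ∧ v ⬝ᵥ Q = 0 ∧ P ⨯₃ Q = v := by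
  obtain ⟨d, hd⟩ := exists_dotProduct_eq_one hv
  obtain ⟨P, hP0, hvP⟩ : ∃ P : Fin 3 → k, P ≠ 0 ∧ v ⬝ᵥ P = 0 := by
    by_cases h : v 0 = 0
    · exact ⟨![1, 0, 0], by simp, by rw [vec3_dotProduct]; simp [h]⟩
    · exact ⟨![v 1, -v 0, 0], by simp [h], by rw [vec3_dotProduct]; simp; ring⟩
  obtain ⟨Q, hQ⟩ := exists_cross_eq hP0 (by rwa [dotProduct_comm] : P ⬝ᵥ v = 0)
  exact ⟨P, Q, hvP, by rw [← hQ, dotProduct_comm]; exact dot_cross_self _ _, hQ⟩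

theorem exists_orthogonal_det_eq_zero [IsAlgClosed k] (p q r : k) {v : Fin 3 → k} (hv : v ≠ 0) :
    ∃ P : Fin 3 → k, P ≠ 0 ∧ v ⬝ᵥ P = 0 ∧ (relMatrix p q r P).det = 0 := by
  obtain ⟨P, Q, hP, hQ, hPQ⟩ := exists_two_orthogonal hv
  by_cases hdet : (relMatrix p q r Q).det = 0
  · refine ⟨Q, ?_, hQ, hdet⟩
    rintro rfl
    exact hv (by simpa using hPQ.symm)
  · rw [det_relMatrix] at hdet
    obtain ⟨t, ht⟩ := exists_cubic_root hdet
      (b := (p ^ 3 + q ^ 3 + r ^ 3) * (P 0 * Q 1 * Q 2 + Q 0 * P 1 * Q 2 + Q 0 * Q 1 * P 2)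
        - p * q * r * (3 * (P 0 * Q 0 ^ 2 + P 1 * Q 1 ^ 2 + P 2 * Q 2 ^ 2)))
      (c := (p ^ 3 + q ^ 3 + r ^ 3) * (P 0 * P 1 * Q 2 + Q 0 * P 1 * P 2 + P 0 * Q 1 * P 2)
        - p * q * r * (3 * (P 0 ^ 2 * Q 0 + P 1 ^ 2 * Q 1 + P 2 ^ 2 * Q 2)))
      (d := (relMatrix p q r P).det)
    refine ⟨P + t • Q, ?_, by simp [dotProduct_add, hP, hQ], ?_⟩
    · intro h0
      rw [eq_neg_of_add_eq_zero_left h0] at hPQ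
      exact hv (by simpa using hPQ.symm)
    · rw [det_relMatrix] at ht ⊢
      simp only [Pi.add_apply, Pi.smul_apply, smul_eq_mul]
      linear_combination ht

end LinearAlgebra

section Presentation

variable {k} {p q r : k}

theorem sgen_relation (c : Fin 3 → k) :
    ∑ i, ∑ l, relMatrix p q r c i l • (sgen k p q r i * sgen k p q r l) = 0 := by
  have key : ∀ a, sklyRel k p q r a 0 → RingQuot.mkAlgHom k (sklyRel k p q r) a = 0 := by
    intro a h
    rw [RingQuot.mkAlgHom_rel k h, map_zero]
  have h0 := key _ ⟨rfl, Or.inl rfl⟩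
  have h1 := key _ ⟨rfl, Or.inr (Or.inl rfl)⟩
  have h2 := key _ ⟨rfl, Or.inr (Or.inr rfl)⟩
  simp only [← Algebra.smul_def, map_add, map_smul, map_mul] at h0 h1 h2
  simp only [Fin.sum_univ_three, relMatrix, sgen]
  simp only [of_apply, cons_val]
  linear_combination (norm := module) c 0 • h0 + c 1 • h1 + c 2 • h2

/-- The universal property of the Sklyanin algebra. -/
theorem exists_algHom {B : Type*} [Ring B] [Algebra k B] (f : Fin 3 → B)
    (h0 : p • (f 1 * f 2) + q • (f 2 * f 1) + r • (f 0 * f 0) = 0)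
    (h1 : p • (f 2 * f 0) + q • (f 0 * f 2) + r • (f 1 * f 1) = 0)
    (h2 : p • (f 0 * f 1) + q • (f 1 * f 0) + r • (f 2 * f 2) = 0) :
    ∃ φ : Skly3 k p q r →ₐ[k] B, ∀ i, φ (sgen k p q r i) = f i := by
  refine ⟨RingQuot.liftAlgHom k ⟨FreeAlgebra.lift k f, ?_⟩, fun i => ?_⟩
  · rintro a _ ⟨rfl, rfl | rfl | rfl⟩ <;>
      simpa [g3, ← Algebra.smul_def]
  · rw [sgen, RingQuot.liftAlgHom_mkAlgHom_apply, g3, FreeAlgebra.lift_ι_apply]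

theorem sgen_induction {motive : Skly3 k p q r → Prop}
    (algebraMap : ∀ c, motive (algebraMap k _ c)) (sgen : ∀ i, motive (sgen k p q r i))
    (mul : ∀ a b, motive a → motive b → motive (a * b))
    (add : ∀ a b, motive a → motive b → motive (a + b)) (a : Skly3 k p q r) : motive a := by
  obtain ⟨a, rfl⟩ := RingQuot.mkAlgHom_surjective k (sklyRel k p q r) a
  induction a using FreeAlgebra.induction with
  | grade0 c => rw [AlgHom.commutes]; exact algebraMap c
  | grade1 i => exact sgen i
  | mul a b ha hb => rw [map_mul]; exact mul _ _ ha hb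
  | add a b ha hb => rw [map_add]; exact add _ _ ha hb

end Presentation

section Grading

variable {k} (p q r : k)

theorem gradedPiece3_zero : gradedPiece3 k p q r 0 = Submodule.span k {1} := by
  unfold gradedPiece3
  congr 1
  ext s
  simp [List.length_eq_zero_iff]

theorem one_mem_gradedPiece3 : (1 : Skly3 k p q r) ∈ gradedPiece3 k p q r 0 :=
  Submodule.subset_span ⟨[], rfl, rfl⟩

theorem sgen_mem_gradedPiece3 (i : Fin 3) : sgen k p q r i ∈ gradedPiece3 k p q r 1 :=
  Submodule.subset_span ⟨[i], rfl, by simp⟩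

instance (n : ℕ) : FiniteDimensional k (gradedPiece3 k p q r n) := by
  refine FiniteDimensional.span_of_finite k ?_
  refine ((List.finite_length_eq (Fin 3) n).image
    fun w => (w.map (sgen k p q r)).prod).subset ?_
  rintro s ⟨w, hw, rfl⟩
  exact ⟨w, hw, rfl⟩

variable {p q r}

theorem mul_mem_gradedPiece3 {m n : ℕ} {a b : Skly3 k p q r} (ha : a ∈ gradedPiece3 k p q r m)
    (hb : b ∈ gradedPiece3 k p q r n) : a * b ∈ gradedPiece3 k p q r (m + n) := by
  have h := Submodule.mul_mem_mul ha hb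
  unfold gradedPiece3 at h
  rw [Submodule.span_mul_span] at h
  refine Submodule.span_mono ?_ h
  rintro _ ⟨_, ⟨v, rfl, rfl⟩, _, ⟨w, rfl, rfl⟩, rfl⟩
  exact ⟨v ++ w, by simp, by simp⟩

theorem sgen_mul_mem {n : ℕ} (i : Fin 3) {a : Skly3 k p q r} (ha : a ∈ gradedPiece3 k p q r n) :
    sgen k p q r i * a ∈ gradedPiece3 k p q r (n + 1) := by
  rw [add_comm]
  exact mul_mem_gradedPiece3 (sgen_mem_gradedPiece3 p q r i) ha

theorem exists_eq_sum_sgen_mul {n : ℕ} {a : Skly3 k p q r}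
    (ha : a ∈ gradedPiece3 k p q r (n + 1)) :
    ∃ b : Fin 3 → gradedPiece3 k p q r n, a = ∑ i, sgen k p q r i * b i := by
  induction ha using Submodule.span_induction with
  | mem x hx =>
    obtain ⟨w, hw, rfl⟩ := hx
    obtain ⟨i, w, rfl⟩ := List.exists_cons_of_length_eq_add_one hw
    refine ⟨Pi.single i ⟨(w.map (sgen k p q r)).prod,
      Submodule.subset_span ⟨w, by simpa using hw, rfl⟩⟩, ?_⟩
    rw [Finset.sum_eq_single i]
    · simp
    · intro j _ hj
      simp [hj]
    · simp
  | zero => exact ⟨0, by simp⟩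
  | add x y _ _ hx hy =>
    obtain ⟨b, rfl⟩ := hx
    obtain ⟨c, rfl⟩ := hy
    exact ⟨b + c, by simp [mul_add, Finset.sum_add_distrib]⟩
  | smul t x _ hx =>
    obtain ⟨b, rfl⟩ := hx
    exact ⟨t • b, by simp [Finset.smul_sum]⟩

variable (p q r)

theorem exists_grading_algHom : ∃ δ : Skly3 k p q r →ₐ[k] (Skly3 k p q r)[X],
    ∀ i, δ (sgen k p q r i) = monomial 1 (sgen k p q r i) := by
  have h := sgen_relation (p := p) (q := q) (r := r)
  have h0 := h ![1, 0, 0]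
  have h1 := h ![0, 1, 0]
  have h2 := h ![0, 0, 1]
  simp only [Fin.sum_univ_three, relMatrix] at h0 h1 h2
  simp only [of_apply, cons_val, mul_zero, zero_smul, add_zero, zero_add, mul_one] at h0 h1 h2
  refine exists_algHom (fun i => monomial 1 (sgen k p q r i)) ?_ ?_ ?_ <;>
    simp only [monomial_mul_monomial, smul_monomial, ← map_add]
  · rw [← map_zero (monomial (1 + 1)), ← h0]; congr 1; abel
  · rw [← map_zero (monomial (1 + 1)), ← h1]; congr 1; abel
  · rw [← map_zero (monomial (1 + 1)), ← h2]

/-- The projections onto the graded components. -/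
theorem exists_projections : ∃ π : ℕ → Skly3 k p q r →ₗ[k] Skly3 k p q r,
    (∀ n a, π n a ∈ gradedPiece3 k p q r n) ∧ (∀ n, ∀ a ∈ gradedPiece3 k p q r n, π n a = a) ∧
    (∀ n i a, π (n + 1) (sgen k p q r i * a) = sgen k p q r i * π n a) ∧
    (∀ i a, π 0 (sgen k p q r i * a) = 0) := by
  obtain ⟨δ, hδ⟩ := exists_grading_algHom p q r
  let π (n : ℕ) : Skly3 k p q r →ₗ[k] Skly3 k p q r :=
    ((lcoeff (Skly3 k p q r) n).restrictScalars k).comp δ.toLinearMap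
  have hπ : ∀ n a, π n a = (δ a).coeff n := fun n a => rfl
  have hsucc : ∀ n i a, π (n + 1) (sgen k p q r i * a) = sgen k p q r i * π n a := by
    intro n i a
    rw [hπ, hπ, map_mul, hδ, coeff_monomial_mul]
  refine ⟨π, fun n a => ?_, fun n => ?_, hsucc, fun i a => ?_⟩
  · rw [hπ]
    induction a using sgen_induction generalizing n with
    | algebraMap c =>
      rw [AlgHom.commutes, Polynomial.algebraMap_apply, coeff_C]
      split_ifs with h
      · rw [h, Algebra.algebraMap_eq_smul_one]
        exact Submodule.smul_mem _ _ (one_mem_gradedPiece3 p q r)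
      · exact Submodule.zero_mem _
    | sgen i =>
      rw [hδ, coeff_monomial]
      split_ifs with h
      · rw [← h]
        exact sgen_mem_gradedPiece3 p q r i
      · exact Submodule.zero_mem _
    | mul a b ha hb =>
      rw [map_mul, coeff_mul]
      refine Submodule.sum_mem _ fun x hx => ?_
      rw [← Finset.HasAntidiagonal.mem_antidiagonal.1 hx]
      exact mul_mem_gradedPiece3 (ha _) (hb _)
    | add a b ha hb =>
      rw [map_add, coeff_add]
      exact Submodule.add_mem _ (ha _) (hb _)
  · induction n with
    | zero =>
      intro a ha
      rw [gradedPiece3_zero] at ha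
      obtain ⟨c, rfl⟩ := Submodule.mem_span_singleton.1 ha
      rw [map_smul, hπ, map_one, coeff_one_zero]
    | succ n ih =>
      intro a ha
      obtain ⟨b, rfl⟩ := exists_eq_sum_sgen_mul ha
      rw [map_sum]
      exact Finset.sum_congr rfl fun i _ => by rw [hsucc, ih _ (b i).2]
  · rw [hπ, map_mul, hδ, mul_coeff_zero]
    simp [coeff_monomial]

end Grading

section LowerBound

variable {k} (p q r : k)

/-- The map `(a₀, a₁, a₂) ↦ x a₀ + y a₁ + z a₂`. -/
def genMap : (Fin 3 → Skly3 k p q r) →ₗ[k] Skly3 k p q r :=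
  ∑ i, (LinearMap.mulLeft k (sgen k p q r i)).comp (LinearMap.proj i)

/-- The map sending `u` to the coefficients `a` for which `x a₀ + y a₁ + z a₂` is the combination
of the defining relations with right coefficients `u`. -/
def relMap : (Fin 3 → Skly3 k p q r) →ₗ[k] (Fin 3 → Skly3 k p q r) :=
  LinearMap.pi fun i => ∑ j, ∑ l, relMatrix p q r (Pi.single j 1) i l •
    (LinearMap.mulLeft k (sgen k p q r l)).comp (LinearMap.proj j)

/-- The map `u ↦ (x u, y u, z u)`. -/
def colMap : Skly3 k p q r →ₗ[k] (Fin 3 → Skly3 k p q r) :=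
  LinearMap.pi fun i => LinearMap.mulLeft k (sgen k p q r i)

variable {p q r}

theorem genMap_apply (a : Fin 3 → Skly3 k p q r) : genMap p q r a = ∑ i, sgen k p q r i * a i := by
  simp [genMap]

theorem relMap_apply (u : Fin 3 → Skly3 k p q r) (i : Fin 3) : relMap p q r u i =
    ∑ j, ∑ l, relMatrix p q r (Pi.single j 1) i l • (sgen k p q r l * u j) := by
  simp [relMap]

theorem colMap_apply (u : Skly3 k p q r) (i : Fin 3) : colMap p q r u i = sgen k p q r i * u :=
  rfl

theorem genMap_relMap (u : Fin 3 → Skly3 k p q r) : genMap p q r (relMap p q r u) = 0 := by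
  simp only [genMap_apply, relMap_apply, Finset.mul_sum, mul_smul_comm, ← mul_assoc]
  rw [Finset.sum_comm]
  refine Finset.sum_eq_zero fun j _ => ?_
  have h := congrArg (· * u j) (sgen_relation (p := p) (q := q) (r := r) (Pi.single j 1))
  simpa only [Finset.sum_mul, smul_mul_assoc, zero_mul] using h

theorem relMap_colMap (u : Skly3 k p q r) : relMap p q r (colMap p q r u) = 0 := by
  ext i
  have h := congrArg (· * u) (sgen_relation (p := p) (q := q) (r := r) (Pi.single i 1))
  simp only [Finset.sum_mul, smul_mul_assoc, zero_mul] at h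
  simp only [relMap_apply, colMap_apply, Pi.zero_apply, ← mul_assoc]
  rw [← h]
  simp only [Fin.sum_univ_three, relMatrix]
  fin_cases i <;> simp <;> abel

/-- Exactness of the Koszul complex at its second term: the quotient of the free module by the
relations, with a unit adjoined, is a left module over the Sklyanin algebra. -/
theorem exists_relMap_eq {a : Fin 3 → Skly3 k p q r} (ha : genMap p q r a = 0) :
    ∃ u, relMap p q r u = a := by
  let Q := (Fin 3 → Skly3 k p q r) ⧸ LinearMap.range (relMap p q r)
  let mk : (Fin 3 → Skly3 k p q r) →ₗ[k] Q := (LinearMap.range (relMap p q r)).mkQ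
  have hmk : ∀ u, mk (relMap p q r u) = 0 := fun u =>
    (Submodule.Quotient.mk_eq_zero _).2 ⟨u, rfl⟩
  let gen : Q →ₗ[k] Skly3 k p q r := (LinearMap.range (relMap p q r)).liftQ (genMap p q r)
    (by rintro _ ⟨u, rfl⟩; exact genMap_relMap u)
  have hgen : ∀ b, gen (mk b) = genMap p q r b := fun b => Submodule.liftQ_apply _ _ _
  let ev : k × Q →ₗ[k] Skly3 k p q r := (Algebra.linearMap k _).coprod gen
  let act (i : Fin 3) : Module.End k (k × Q) :=
    LinearMap.inr k k Q ∘ₗ mk ∘ₗ LinearMap.single k (fun _ => Skly3 k p q r) i ∘ₗ ev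
  have hact : ∀ i w, act i w = (0, mk (Pi.single i (ev w))) := fun i w => rfl
  have hev : ∀ i w, ev (act i w) = sgen k p q r i * ev w := by
    intro i w
    rw [hact, LinearMap.coprod_apply, hgen, genMap_apply, Finset.sum_eq_single i]
    · simp
    · intro j _ hj
      simp [hj]
    · simp
  have hact2 : ∀ i l w, (act i * act l) w = (0, mk (Pi.single i (sgen k p q r l * ev w))) := by
    intro i l w
    rw [Module.End.mul_apply, hact, hev]
  have hrel : ∀ j w, ∑ i, ∑ l, relMatrix p q r (Pi.single j 1) i l • (act i * act l) w = 0 := by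
    intro j w
    have h := hmk (Pi.single j (ev w))
    have h2 : relMap p q r (Pi.single j (ev w)) = ∑ i, ∑ l, relMatrix p q r (Pi.single j 1) i l •
        (Pi.single i (sgen k p q r l * ev w) : Fin 3 → Skly3 k p q r) := by
      ext m
      rw [relMap_apply, Finset.sum_eq_single j (by intro i _ hi; simp [hi]) (by simp),
        Finset.sum_apply]
      symm
      rw [Finset.sum_eq_single m]
      · simp
      · intro i _ hi
        simp [hi.symm]
      · simp
    rw [h2] at h
    simp only [map_sum, map_smul] at h
    simp only [hact2]
    ext
    · simp [Prod.fst_sum]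
    · simpa [Prod.snd_sum] using h
  simp only [Fin.sum_univ_three, relMatrix] at hrel
  obtain ⟨φ, hφ⟩ := exists_algHom (p := p) (q := q) (r := r) act
    (LinearMap.ext fun w => by have h := hrel 0 w; simp at h ⊢; rw [← h]; abel)
    (LinearMap.ext fun w => by have h := hrel 1 w; simp at h ⊢; rw [← h]; abel)
    (LinearMap.ext fun w => by have h := hrel 2 w; simp at h ⊢; rw [← h])
  have hφ1 : ∀ b w, ev (φ b w) = b * ev w := by
    intro b
    induction b using sgen_induction with
    | algebraMap c =>
      intro w
      rw [AlgHom.commutes, Module.algebraMap_end_apply, map_smul, Algebra.smul_def]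
    | sgen i => intro w; rw [hφ, hev]
    | mul b c hb hc => intro w; rw [map_mul, Module.End.mul_apply, hb, hc, mul_assoc]
    | add b c hb hc => intro w; rw [map_add, LinearMap.add_apply, map_add, hb, hc, add_mul]
  have h1 : ev (1, 0) = 1 := by simp [ev]
  have key : φ (genMap p q r a) (1, 0) = (0, mk a) := by
    have ha' : a = ∑ i, Pi.single i (a i) := (Finset.univ_sum_single a).symm
    rw [genMap_apply, map_sum, LinearMap.sum_apply]
    conv_rhs => rw [ha', map_sum]
    simp only [map_mul, Module.End.mul_apply, hφ, hact, hφ1, h1, mul_one]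
    ext
    · simp [Prod.fst_sum]
    · simp [Prod.snd_sum]
  rw [ha, map_zero, LinearMap.zero_apply] at key
  exact (Submodule.Quotient.mk_eq_zero _).1 (congrArg Prod.snd key).symm

theorem relMap_mem {n : ℕ} {u : Fin 3 → Skly3 k p q r} (hu : ∀ i, u i ∈ gradedPiece3 k p q r n)
    (i : Fin 3) : relMap p q r u i ∈ gradedPiece3 k p q r (n + 1) := by
  rw [relMap_apply]
  exact Submodule.sum_mem _ fun j _ => Submodule.sum_mem _ fun l _ =>
    Submodule.smul_mem _ _ (sgen_mul_mem l (hu j))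

variable (p q r)

/-- The inclusion of triples of homogeneous elements of degree `n`. -/
abbrev gradedIncl (n : ℕ) : (Fin 3 → gradedPiece3 k p q r n) →ₗ[k] (Fin 3 → Skly3 k p q r) :=
  (gradedPiece3 k p q r n).subtype.compLeft (Fin 3)

/-- The restriction of `genMap` to triples of homogeneous elements of degree `n`. -/
abbrev gradedGenMap (n : ℕ) : (Fin 3 → gradedPiece3 k p q r n) →ₗ[k] Skly3 k p q r :=
  genMap p q r ∘ₗ gradedIncl p q r n

/-- The restriction of `relMap` to triples of homogeneous elements of degree `n`. -/
abbrev gradedRelMap (n : ℕ) :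
    (Fin 3 → gradedPiece3 k p q r n) →ₗ[k] (Fin 3 → Skly3 k p q r) :=
  relMap p q r ∘ₗ gradedIncl p q r n

theorem gradedIncl_injective (n : ℕ) : Function.Injective (gradedIncl p q r n) := by
  intro a b h
  ext i
  exact congrFun h i

theorem range_genMap (n : ℕ) : LinearMap.range (gradedGenMap p q r n) =
    gradedPiece3 k p q r (n + 1) := by
  apply le_antisymm
  · rintro _ ⟨a, rfl⟩
    rw [LinearMap.comp_apply, genMap_apply]
    exact Submodule.sum_mem _ fun i _ => sgen_mul_mem i (a i).2
  · intro a ha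
    obtain ⟨b, rfl⟩ := exists_eq_sum_sgen_mul ha
    exact ⟨b, by rw [LinearMap.comp_apply, genMap_apply]; rfl⟩

theorem map_ker_genMap (n : ℕ) :
    (LinearMap.ker (gradedGenMap p q r (n + 1))).map (gradedIncl p q r (n + 1)) =
      LinearMap.range (gradedRelMap p q r n) := by
  apply le_antisymm
  · rintro _ ⟨a, ha, rfl⟩
    obtain ⟨u, hu⟩ := exists_relMap_eq (LinearMap.mem_ker.1 ha)
    obtain ⟨π, hmem, hid, hsucc, -⟩ := exists_projections p q r
    refine ⟨fun j => ⟨π n (u j), hmem _ _⟩, ?_⟩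
    ext i
    have h : gradedIncl p q r (n + 1) a i = π (n + 1) (gradedIncl p q r (n + 1) a i) :=
      (hid _ _ (a i).2).symm
    rw [h, ← hu, LinearMap.comp_apply, relMap_apply, relMap_apply]
    simp only [map_sum, map_smul, hsucc]
    rfl
  · rintro _ ⟨u, rfl⟩
    refine ⟨fun i => ⟨_, relMap_mem (fun j => (u j).2) i⟩, ?_, rfl⟩
    exact genMap_relMap _

theorem finrank_triple (n : ℕ) : Module.finrank k (Fin 3 → gradedPiece3 k p q r n) =
    3 * Module.finrank k (gradedPiece3 k p q r n) := by
  have : Module.Free k (gradedPiece3 k p q r n) :=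
    Module.Free.of_divisionRing k (gradedPiece3 k p q r n)
  simp [Module.finrank_pi_fintype]

theorem finrank_succ_succ (n : ℕ) : Module.finrank k (gradedPiece3 k p q r (n + 2)) +
    Module.finrank k (LinearMap.range (gradedRelMap p q r n)) =
      3 * Module.finrank k (gradedPiece3 k p q r (n + 1)) := by
  have h := LinearMap.finrank_range_add_finrank_ker (K := k)
    (V := Fin 3 → gradedPiece3 k p q r (n + 1)) (V₂ := Skly3 k p q r) (gradedGenMap p q r (n + 1))
  rw [range_genMap, (Submodule.equivMapOfInjective _ (gradedIncl_injective p q r (n + 1))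
    _).finrank_eq,
    map_ker_genMap, finrank_triple] at h
  exact h

theorem finrank_zero : Module.finrank k (gradedPiece3 k p q r 0) = 1 := by
  obtain ⟨φ, -⟩ := exists_algHom (p := p) (q := q) (r := r) (B := k) 0
    (by simp) (by simp) (by simp)
  have := φ.toRingHom.domain_nontrivial
  rw [gradedPiece3_zero]
  exact finrank_span_singleton one_ne_zero

theorem finrank_one : Module.finrank k (gradedPiece3 k p q r 1) = 3 := by
  have h := LinearMap.finrank_range_add_finrank_ker (K := k)
    (V := Fin 3 → gradedPiece3 k p q r 0) (V₂ := Skly3 k p q r) (gradedGenMap p q r 0)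
  have hker : LinearMap.ker (gradedGenMap p q r 0) = ⊥ := by
    refine LinearMap.ker_eq_bot'.2 fun a ha => ?_
    obtain ⟨u, hu⟩ := exists_relMap_eq ha
    obtain ⟨π, -, hid, -, hzero⟩ := exists_projections p q r
    ext i
    have h : gradedIncl p q r 0 a i = π 0 (gradedIncl p q r 0 a i) := (hid _ _ (a i).2).symm
    rw [← hu, relMap_apply] at h
    simp only [map_sum, map_smul, hzero, smul_zero, Finset.sum_const_zero] at h
    rw [← relMap_apply, hu] at h
    exact h
  rw [range_genMap, hker, finrank_triple] at h
  simpa [finrank_zero] using h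

theorem finrank_two_ge : 6 ≤ Module.finrank k (gradedPiece3 k p q r 2) := by
  have h1 := finrank_succ_succ p q r 0
  have h2 := LinearMap.finrank_range_add_finrank_ker (K := k)
    (V := Fin 3 → gradedPiece3 k p q r 0) (V₂ := Fin 3 → Skly3 k p q r) (gradedRelMap p q r 0)
  rw [finrank_triple] at h2
  rw [finrank_zero] at h2
  rw [zero_add, zero_add, finrank_one] at h1
  omega

theorem finrank_add_three_ge {n : ℕ} (hinj : ∀ a ∈ gradedPiece3 k p q r n,
    sgen k p q r 0 * a = 0 → a = 0) :
    3 * Module.finrank k (gradedPiece3 k p q r (n + 2)) +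
      Module.finrank k (gradedPiece3 k p q r n) ≤
    Module.finrank k (gradedPiece3 k p q r (n + 3)) +
      3 * Module.finrank k (gradedPiece3 k p q r (n + 1)) := by
  have h1 : Module.finrank k (gradedPiece3 k p q r (n + 3)) +
      Module.finrank k (LinearMap.range (gradedRelMap p q r (n + 1))) =
      3 * Module.finrank k (gradedPiece3 k p q r (n + 2)) := finrank_succ_succ p q r (n + 1)
  have h2 := LinearMap.finrank_range_add_finrank_ker (K := k)
    (V := Fin 3 → gradedPiece3 k p q r (n + 1)) (V₂ := Fin 3 → Skly3 k p q r)
    (gradedRelMap p q r (n + 1))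
  rw [finrank_triple] at h2
  let f : gradedPiece3 k p q r n →ₗ[k]
      LinearMap.ker (gradedRelMap p q r (n + 1)) :=
    { toFun := fun a => ⟨fun i => ⟨sgen k p q r i * a, sgen_mul_mem i a.2⟩, relMap_colMap _⟩
      map_add' := fun a b => by ext; simp [mul_add]
      map_smul' := fun c a => by ext; simp }
  have hf : Function.Injective f := by
    intro a b hab
    have h0 : sgen k p q r 0 * (a : Skly3 k p q r) = sgen k p q r 0 * b :=
      congrArg Subtype.val (congrFun (congrArg Subtype.val hab) 0)
    refine Subtype.ext (sub_eq_zero.1 (hinj _ (Submodule.sub_mem _ a.2 b.2) ?_))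
    rw [mul_sub, h0, sub_self]
  have : Module.Finite k (LinearMap.ker (gradedRelMap p q r (n + 1))) :=
    FiniteDimensional.finiteDimensional_submodule
      (V := Fin 3 → gradedPiece3 k p q r (n + 1)) _
  have h3 := LinearMap.finrank_le_finrank_of_injective hf
  omega

end LowerBound

section UpperBound

variable {k} (p q r : k)

/-- The linear form in the generators with the given coefficients. -/
def lin : (Fin 3 → k) →ₗ[k] Skly3 k p q r := Fintype.linearCombination k (sgen k p q r)

/-- The coefficient vectors of the linear forms vanishing at the point `P`. -/
def formsVanishingAt (P : Fin 3 → k) : Submodule k (Fin 3 → k) :=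
  LinearMap.ker (Fintype.linearCombination k P)

/-- The graded components shifted by one, with zero component in degree `0`. -/
def shiftedPiece : ℕ → Submodule k (Skly3 k p q r)
  | 0 => ⊥
  | n + 1 => gradedPiece3 k p q r n

variable {p q r}

theorem mem_formsVanishingAt {P t : Fin 3 → k} : t ∈ formsVanishingAt P ↔ t ⬝ᵥ P = 0 := Iff.rfl

theorem lin_apply (v : Fin 3 → k) : lin p q r v = ∑ i, v i • sgen k p q r i := rfl

theorem lin_single (i : Fin 3) : lin p q r (Pi.single i 1) = sgen k p q r i := by
  simp [lin]

theorem range_lin_le : LinearMap.range (lin p q r) ≤ gradedPiece3 k p q r 1 := by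
  rintro _ ⟨v, rfl⟩
  rw [lin_apply]
  exact Submodule.sum_mem _ fun i _ => Submodule.smul_mem _ _ (sgen_mem_gradedPiece3 p q r i)

theorem gradedPiece3_succ_le (n : ℕ) :
    gradedPiece3 k p q r (n + 1) ≤ LinearMap.range (lin p q r) * gradedPiece3 k p q r n := by
  intro a ha
  obtain ⟨b, rfl⟩ := exists_eq_sum_sgen_mul ha
  exact Submodule.sum_mem _ fun i _ => Submodule.mul_mem_mul ⟨_, lin_single i⟩ (b i).2

theorem range_lin_mul_shiftedPiece_le (n : ℕ) :
    LinearMap.range (lin p q r) * shiftedPiece p q r n ≤ gradedPiece3 k p q r n := by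
  cases n with
  | zero => rw [shiftedPiece, Submodule.mul_bot]; exact bot_le
  | succ n =>
    refine Submodule.mul_le.2 fun a ha b hb => ?_
    rw [add_comm]
    exact mul_mem_gradedPiece3 (range_lin_le ha) hb

/-- The relation with coefficients `c`, expanded at the point `P`. -/
theorem lin_mul_lin_vecMul (P u c : Fin 3 → k) :
    lin p q r u * lin p q r (P ᵥ* relMatrix p q r c) =
      ∑ i, lin p q r (P i • u - Pi.single i 1) * lin p q r (relMatrix p q r c i) := by
  have h := sgen_relation (p := p) (q := q) (r := r) c
  have h' : ∑ i, sgen k p q r i * lin p q r (relMatrix p q r c i) = 0 := by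
    rw [← h]
    refine Finset.sum_congr rfl fun i _ => ?_
    rw [lin_apply, Finset.mul_sum]
    exact Finset.sum_congr rfl fun l _ => mul_smul_comm _ _ _
  have h'' : P ᵥ* relMatrix p q r c = ∑ i, P i • relMatrix p q r c i := by
    ext l
    simp [vecMul, dotProduct]
  simp only [map_sub, map_smul, lin_single, sub_mul, Finset.sum_sub_distrib, h', sub_zero, h'',
    map_sum, Finset.mul_sum, smul_mul_assoc, mul_smul_comm]

/-- A relation whose coefficient matrix has rank at most two. -/
theorem lin_mul_lin_add {c v w a b : Fin 3 → k}
    (h : ∀ i l, relMatrix p q r c i l = a l * v i + b l * w i) :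
    lin p q r v * lin p q r a + lin p q r w * lin p q r b = 0 := by
  rw [← sgen_relation (p := p) (q := q) (r := r) c]
  simp only [lin_apply, h, Finset.sum_mul_sum, ← Finset.sum_add_distrib, smul_mul_smul_comm]
  refine Finset.sum_congr rfl fun i _ => Finset.sum_congr rfl fun l _ => ?_
  module

/-- Modulo the linear forms vanishing at a point, every graded component is at most
one-dimensional. -/
theorem exists_le_span_sup_vanishing (h : ¬ Degenerate k p q r) (n : ℕ) {P : Fin 3 → k}
    (hP : P ≠ 0) : ∃ c, gradedPiece3 k p q r n ≤
      Submodule.span k {c} ⊔ (formsVanishingAt P).map (lin p q r) * shiftedPiece p q r n := by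
  induction n generalizing P with
  | zero => exact ⟨1, by rw [gradedPiece3_zero]; exact le_sup_left⟩
  | succ n ih =>
    obtain ⟨u, hu⟩ := exists_dotProduct_eq_one hP
    obtain ⟨i, j, hij⟩ := exists_minor_ne_zero (fun h' => h (degenerate_swap h')) hP
    obtain ⟨d, hd⟩ := exists_dotProduct_eq_one hij
    obtain ⟨c, hc⟩ := ih hij
    have hrange : LinearMap.range (lin p q r) ≤
        Submodule.span k {lin p q r u} ⊔ (formsVanishingAt P).map (lin p q r) := by
      rintro _ ⟨t, rfl⟩
      refine Submodule.mem_sup.2 ⟨(t ⬝ᵥ P) • lin p q r u,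
        Submodule.smul_mem _ _ (Submodule.mem_span_singleton_self _),
        lin p q r (t - (t ⬝ᵥ P) • u), Submodule.mem_map_of_mem ?_, by simp⟩
      rw [mem_formsVanishingAt, sub_dotProduct, smul_dotProduct, dotProduct_comm u, hu]
      simp
    have hmul : Submodule.span k {lin p q r u} *
        (formsVanishingAt (relMatrix q p r P i ⨯₃ relMatrix q p r P j)).map (lin p q r) ≤
        (formsVanishingAt P).map (lin p q r) * LinearMap.range (lin p q r) := by
      rw [← Submodule.span_eq ((formsVanishingAt (_ ⨯₃ _)).map (lin p q r)),
        Submodule.span_mul_span, Submodule.span_le]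
      rintro _ ⟨_, rfl, _, ⟨t, ht, rfl⟩, rfl⟩
      have ht' := eq_combination_of_dotProduct_cross hd ht
      obtain ⟨e, he⟩ : ∃ e, t = e ᵥ* relMatrix q p r P := by
        refine ⟨Pi.single i (t ⬝ᵥ (relMatrix q p r P j ⨯₃ d)) +
          Pi.single j (t ⬝ᵥ (d ⨯₃ relMatrix q p r P i)), ?_⟩
        rw [add_vecMul, single_vecMul, single_vecMul]
        exact ht'
      rw [he, ← vecMul_relMatrix]
      simp only [lin_mul_lin_vecMul]
      refine Submodule.sum_mem _ fun l _ =>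
        Submodule.mul_mem_mul (Submodule.mem_map_of_mem ?_) ⟨_, rfl⟩
      rw [mem_formsVanishingAt, sub_dotProduct, smul_dotProduct, dotProduct_comm u, hu]
      simp
    refine ⟨lin p q r u * c, (gradedPiece3_succ_le n).trans ?_⟩
    refine (mul_le_mul' hrange le_rfl).trans ?_
    rw [Submodule.sup_mul]
    refine sup_le ((mul_le_mul' le_rfl hc).trans ?_) le_sup_right
    rw [Submodule.mul_sup, Submodule.span_mul_span, Set.singleton_mul_singleton, ← mul_assoc]
    refine sup_le_sup_left ((mul_le_mul' hmul le_rfl).trans ?_) _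
    rw [mul_assoc]
    exact mul_le_mul' le_rfl (range_lin_mul_shiftedPiece_le n)

/-- Modulo a nonzero linear form, the component of degree `n` has dimension at most `n + 1`. -/
theorem exists_le_span_sup_lin [IsAlgClosed k] (h : ¬ Degenerate k p q r) (n : ℕ)
    {v : Fin 3 → k} (hv : v ≠ 0) :
    ∃ s : Finset (Skly3 k p q r), s.card ≤ n + 1 ∧ gradedPiece3 k p q r n ≤
      Submodule.span k s ⊔ Submodule.span k {lin p q r v} * shiftedPiece p q r n := by
  classical
  induction n generalizing v with
  | zero => exact ⟨{1}, by simp, by rw [gradedPiece3_zero]; simp⟩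
  | succ n ih =>
    obtain ⟨P, hP, hvP, hdet⟩ := exists_orthogonal_det_eq_zero q p r hv
    obtain ⟨c, hc, hcP⟩ := exists_vecMul_eq_zero_iff.2 hdet
    rw [← vecMul_relMatrix] at hcP
    obtain ⟨w, rfl⟩ := exists_cross_eq hv hvP
    obtain ⟨d, hd⟩ := exists_dotProduct_eq_one hP
    have hvan : ∀ t, t ⬝ᵥ (v ⨯₃ w) = 0 →
      t = (t ⬝ᵥ (w ⨯₃ d)) • v + (t ⬝ᵥ (d ⨯₃ v)) • w := fun t ht =>
        eq_combination_of_dotProduct_cross hd ht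
    have hmap : (formsVanishingAt (v ⨯₃ w)).map (lin p q r) ≤
        Submodule.span k {lin p q r v} ⊔ Submodule.span k {lin p q r w} := by
      rintro _ ⟨t, ht, rfl⟩
      rw [hvan t ht, map_add, map_smul, map_smul]
      exact Submodule.add_mem_sup (Submodule.smul_mem _ _ (Submodule.mem_span_singleton_self _))
        (Submodule.smul_mem _ _ (Submodule.mem_span_singleton_self _))
    obtain ⟨a, b, hab⟩ : ∃ a b : Fin 3 → k,
        ∀ i l, relMatrix p q r c i l = a l * v i + b l * w i := by
      refine ⟨fun l => (fun i => relMatrix p q r c i l) ⬝ᵥ (w ⨯₃ d),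
        fun l => (fun i => relMatrix p q r c i l) ⬝ᵥ (d ⨯₃ v), fun i l => ?_⟩
      have hl : (fun i => relMatrix p q r c i l) ⬝ᵥ (v ⨯₃ w) = 0 := by
        rw [dotProduct_comm]
        exact congrFun hcP l
      exact congrFun (hvan _ hl) i
    have hb : b ≠ 0 := by
      rintro rfl
      obtain ⟨i, j, hij⟩ := exists_minor_ne_zero h hc
      refine hij ?_
      have hrow : ∀ i, relMatrix p q r c i = v i • a := fun i => by
        ext l
        simp [hab, mul_comm]
      rw [hrow, hrow]
      simp
    obtain ⟨e, he⟩ := exists_le_span_sup_vanishing h (n + 1) hP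
    obtain ⟨s, hs, hle⟩ := ih hb
    have hmul : Submodule.span k {lin p q r w} * Submodule.span k {lin p q r b} ≤
        Submodule.span k {lin p q r v} * LinearMap.range (lin p q r) := by
      rw [Submodule.span_mul_span, Set.singleton_mul_singleton,
        Submodule.span_singleton_le_iff_mem, eq_neg_of_add_eq_zero_right (lin_mul_lin_add hab)]
      exact Submodule.neg_mem _
        (Submodule.mul_mem_mul (Submodule.mem_span_singleton_self _) ⟨a, rfl⟩)
    refine ⟨insert e (s.image (lin p q r w * ·)), ?_, he.trans ?_⟩
    · have h1 := Finset.card_insert_le e (s.image (lin p q r w * ·))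
      have h2 := Finset.card_image_le (s := s) (f := (lin p q r w * ·))
      omega
    rw [Finset.coe_insert, Finset.coe_image, Submodule.span_insert, sup_assoc]
    refine sup_le_sup_left ((mul_le_mul' hmap le_rfl).trans ?_) _
    rw [Submodule.sup_mul]
    refine sup_le le_sup_right ((mul_le_mul' le_rfl hle).trans ?_)
    rw [Submodule.mul_sup, Submodule.span_mul_span, Set.singleton_mul, ← mul_assoc]
    refine sup_le_sup_left ((mul_le_mul' hmul le_rfl).trans ?_) _
    rw [mul_assoc]
    exact mul_le_mul' le_rfl (range_lin_mul_shiftedPiece_le n)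

/-- Modulo the image of left multiplication by the first generator, the component of degree `n + 1`
has dimension at most `n + 2`. -/
theorem finrank_succ_le [IsAlgClosed k] (h : ¬ Degenerate k p q r) (n : ℕ) :
    Module.finrank k (gradedPiece3 k p q r (n + 1)) ≤ n + 2 + Module.finrank k
      ((gradedPiece3 k p q r n).map (LinearMap.mulLeft k (sgen k p q r 0))) := by
  obtain ⟨s, hs, hle⟩ := exists_le_span_sup_lin h (n + 1)
    (v := Pi.single 0 1) (by simp)
  rw [lin_single, shiftedPiece] at hle
  have himage : Submodule.span k {sgen k p q r 0} * gradedPiece3 k p q r n ≤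
      (gradedPiece3 k p q r n).map (LinearMap.mulLeft k (sgen k p q r 0)) := by
    refine Submodule.mul_le.2 fun a ha b hb => ?_
    obtain ⟨c, rfl⟩ := Submodule.mem_span_singleton.1 ha
    exact ⟨c • b, Submodule.smul_mem _ _ hb, by simp⟩
  have h1 := Submodule.finrank_mono (hle.trans (sup_le_sup_left himage _))
  have h2 := Submodule.finrank_add_le_finrank_add_finrank
    (Submodule.span k (s : Set (Skly3 k p q r)))
    ((gradedPiece3 k p q r n).map (LinearMap.mulLeft k (sgen k p q r 0)))
  have h3 : Module.finrank k (Submodule.span k (s : Set (Skly3 k p q r))) ≤ s.card :=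
    finrank_span_finset_le_card s
  omega

end UpperBound

section HilbertSeries

variable {k} {p q r : k}

theorem eq_zero_of_sgen_mul_eq_zero [IsAlgClosed k] (h : ¬ Degenerate k p q r) {n : ℕ}
    (hn : Module.finrank k (gradedPiece3 k p q r (n + 1)) =
      Module.finrank k (gradedPiece3 k p q r n) + (n + 2))
    (a : Skly3 k p q r) (ha : a ∈ gradedPiece3 k p q r n) (h0 : sgen k p q r 0 * a = 0) :
    a = 0 := by
  let f : gradedPiece3 k p q r n →ₗ[k] Skly3 k p q r :=
    (LinearMap.mulLeft k (sgen k p q r 0)).domRestrict (gradedPiece3 k p q r n)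
  have h1 := LinearMap.finrank_range_add_finrank_ker (K := k)
    (V := gradedPiece3 k p q r n) (V₂ := Skly3 k p q r) f
  have h2 := finrank_succ_le h n
  have h3 : LinearMap.range f =
    (gradedPiece3 k p q r n).map (LinearMap.mulLeft k (sgen k p q r 0)) :=
      LinearMap.range_domRestrict _ _
  rw [h3] at h1
  have h4 : LinearMap.ker f = ⊥ := by
    have : Module.Finite k (LinearMap.ker f) :=
      FiniteDimensional.finiteDimensional_submodule (V := gradedPiece3 k p q r n) _
    refine (Submodule.finrank_eq_zero (R := k) (M := gradedPiece3 k p q r n)).1 ?_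
    omega
  exact congrArg Subtype.val (LinearMap.ker_eq_bot'.1 h4 ⟨a, ha⟩ h0)

theorem finrank_succ_le_add [IsAlgClosed k] (h : ¬ Degenerate k p q r) (n : ℕ) :
    Module.finrank k (gradedPiece3 k p q r (n + 1)) ≤
      Module.finrank k (gradedPiece3 k p q r n) + (n + 2) := by
  have h1 := finrank_succ_le h n
  have h2 := Submodule.finrank_map_le (LinearMap.mulLeft k (sgen k p q r 0))
    (gradedPiece3 k p q r n)
  omega

theorem finrank_succ [IsAlgClosed k] (h : ¬ Degenerate k p q r) (n : ℕ) :
    Module.finrank k (gradedPiece3 k p q r (n + 1)) =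
      Module.finrank k (gradedPiece3 k p q r n) + (n + 2) := by
  induction n using Nat.strong_induction_on with
  | _ n ih =>
    refine le_antisymm (finrank_succ_le_add h n) ?_
    match n, ih with
    | 0, _ => rw [finrank_zero, zero_add, finrank_one]
    | 1, _ => exact (finrank_one p q r).symm ▸ finrank_two_ge p q r
    | n + 2, ih =>
      have h0 := ih n (by omega)
      have h1 : Module.finrank k (gradedPiece3 k p q r (n + 2)) =
        Module.finrank k (gradedPiece3 k p q r (n + 1)) + (n + 1 + 2) := ih (n + 1) (by omega)
      have h2 := finrank_add_three_ge p q r (eq_zero_of_sgen_mul_eq_zero h h0)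
      change _ ≤ Module.finrank k (gradedPiece3 k p q r (n + 3))
      omega

end HilbertSeries

end Sklyanin3

/-- For a non-degenerate triple `(p,q,r)` over an algebraically closed field, the `n`-th
graded component of `S(p,q,r)` has dimension `C(n+2,2)`; that is, `S(p,q,r)` has the Hilbert
series `1/(1−t)³` of a polynomial ring in three variables. -/
theorem sklyanin3_hilbert_series [IsAlgClosed k] (p q r : k)
    (hne : ¬(p = 0 ∧ q = 0 ∧ r = 0)) (hnondeg : ¬ Degenerate k p q r) (n : ℕ) :
    Module.finrank k ↥(gradedPiece3 k p q r n) = Nat.choose (n + 2) 2 := by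
  induction n with
  | zero => simpa using Sklyanin3.finrank_zero p q r
  | succ n ih =>
    have hchoose : (n + 3).choose 2 = (n + 2).choose 1 + (n + 2).choose 2 :=
      Nat.choose_succ_succ' _ _
    rw [Sklyanin3.finrank_succ hnondeg, ih, show n + 1 + 2 = n + 3 from rfl, hchoose,
      Nat.choose_one_right]
    omega
end
end
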